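/- Let q = s^2 be a square prime power, let n ≥ 2 be even, and let X be a hypersurface of degree d = s+1 and dimension n in P^{n+1} over F_q with 0 < k_X ≤ n−1 such that N_q(X) = Θ_{n,k_X}^{s+1,q} and X has no singular F_q-point. Then k_X = n/2 and there exist T ∈ GL_{n+2}(F_q) and c ∈ F_q^× such that f(T·x) = c·(X_0^{s+1} + X_1^{s+1} + … + X_{n+1}^{s+1}); that is, X is projectively equivalent over F_q to a nonsingular Hermitian hypersurface. -/

import Mathlib

/-- `NP q N` is the number of `F_q`-points of `P^N`, i.e. `q^N + q^(N-1) + … + q + 1`. -/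
def NP (q N : ℕ) : ℕ := ∑ i ∈ Finset.range (N + 1), q ^ i

/-- `Theta q d n k` is the quantity `Θ_{n,k}^{d,q} = (d-1)·q^k·N_q(P^{n-k}) + N_q(P^k)`. -/
def Theta (q d n k : ℕ) : ℕ := (d - 1) * q ^ k * NP q (n - k) + NP q k

/-- The number of `F`-rational points of the hypersurface `f = 0` in `P^{m-1}`. -/
noncomputable def numPoints {F : Type*} [Field F] {m : ℕ}
    (f : MvPolynomial (Fin m) F) : ℕ :=
  Nat.card {p : Projectivization F (Fin m → F) // MvPolynomial.eval p.rep f = 0}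

/-- The projective linear subspace `P(W)` is contained in the hypersurface `f = 0`. -/
def SubInX {F : Type*} [Field F] {m : ℕ}
    (f : MvPolynomial (Fin m) F) (W : Submodule F (Fin m → F)) : Prop :=
  ∀ v ∈ W, MvPolynomial.eval v f = 0

/-- The Thas invariant of the hypersurface `f = 0` equals `k`: there is an `F`-linear
projective subspace of dimension `k` contained in it, and none of dimension `k + 1`. -/
def ThasEq {F : Type*} [Field F] {m : ℕ}
    (f : MvPolynomial (Fin m) F) (k : ℕ) : Prop :=
  (∃ W : Submodule F (Fin m → F), Module.finrank F W = k + 1 ∧ SubInX f W) ∧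
  ¬ ∃ W : Submodule F (Fin m → F), Module.finrank F W = k + 2 ∧ SubInX f W

/-- `v` is a homogeneous coordinate vector of a singular `F`-point of `f = 0`. -/
def IsSingPt {F : Type*} [Field F] {m : ℕ}
    (f : MvPolynomial (Fin m) F) (v : Fin m → F) : Prop :=
  v ≠ 0 ∧ MvPolynomial.eval v f = 0 ∧
    ∀ i, MvPolynomial.eval v (MvPolynomial.pderiv i f) = 0
open Polynomial in
theorem coeff_eq_of_sum_eq {F : Type*} [Field F] [Fintype F] {D : ℕ} (hD : D < Fintype.card F)
    {c c' : ℕ → F}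
    (h : ∀ t : F, ∑ i ∈ Finset.range (D + 1), c i * t ^ i =
      ∑ i ∈ Finset.range (D + 1), c' i * t ^ i) :
    ∀ i ≤ D, c i = c' i := by
  intro i hi
  set p : F[X] := ∑ i ∈ Finset.range (D + 1), C (c i - c' i) * X ^ i with hp
  have hdeg : p.natDegree ≤ D := by
    refine natDegree_sum_le_of_forall_le _ _ fun j hj => ?_
    exact (natDegree_C_mul_X_pow_le _ _).trans (by simpa [Nat.lt_succ_iff] using hj)
  have h0 : p = 0 := by
    refine eq_zero_of_natDegree_lt_card_of_eval_eq_zero p Function.injective_id (fun t => ?_)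
      (by omega)
    simp [hp, eval_finsetSum, sub_mul, Finset.sum_sub_distrib, h t]
  have := congrArg (fun r => r.coeff i) h0
  simpa only [hp, finsetSum_coeff, coeff_C_mul, coeff_X_pow, mul_ite, mul_one, mul_zero,
    Finset.sum_ite_eq, Finset.mem_range, Nat.lt_succ_iff, hi, if_true, coeff_zero, sub_eq_zero]
    using this

namespace MvPolynomial

variable {F : Type*} [Field F] {m D : ℕ}

/-- A form of degree `D`, restricted to a three-parameter family of vectors. -/
theorem IsHomogeneous.exists_coeff_three {f : MvPolynomial (Fin m) F} (hf : f.IsHomogeneous D)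
    (u v w : Fin m → F) :
    ∃ c : ℕ → ℕ → F, (∀ i j, D < i + j → c i j = 0) ∧
      ∀ a b t : F, eval (a • u + b • v + t • w) f =
        ∑ j ∈ Finset.range (D + 1), (∑ i ∈ Finset.range (D + 1),
          c i j * a ^ (D - i - j) * b ^ i) * t ^ j := by
  classical
  set g : MvPolynomial (Fin 3) F :=
    MvPolynomial.aeval (fun i => C (u i) * X 0 + C (v i) * X 1 + C (w i) * X 2) f with hg
  have hgh : g.IsHomogeneous D := by
    have := hf.aeval (n := 1)
      (fun i => C (u i) * X (0 : Fin 3) + C (v i) * X 1 + C (w i) * X 2 : Fin m → _)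
      fun i => ((isHomogeneous_C_mul_X _ _).add (isHomogeneous_C_mul_X _ _)).add
        (isHomogeneous_C_mul_X _ _)
    rwa [one_mul] at this
  have hsum : ∀ d ∈ g.support, d 0 + d 1 + d 2 = D := by
    intro d hd
    have := hgh.degree_eq_sum_deg_support hd
    rw [← Finsupp.degree_apply, Finsupp.degree_eq_sum, Fin.sum_univ_three] at this
    exact this.symm
  refine ⟨fun i j => ∑ d ∈ g.support with (d 2, d 1) = (j, i), g.coeff d, ?_, ?_⟩
  · intro i j hij
    refine Finset.sum_eq_zero fun d hd => ?_
    rw [Finset.mem_filter, Prod.mk.injEq] at hd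
    have := hsum d hd.1
    omega
  · intro a b t
    have h1 : eval (a • u + b • v + t • w) f = eval ![a, b, t] g := by
      rw [hg, ← aeval_eq_eval, ← aeval_eq_eval, ← AlgHom.comp_apply, comp_aeval]
      congr 2
      funext i
      simp
      ring
    rw [h1, eval_eq', ← Finset.sum_fiberwise_of_maps_to
      (t := Finset.range (D + 1) ×ˢ Finset.range (D + 1)) (g := fun d => (d 2, d 1)),
      Finset.sum_product]
    · refine Finset.sum_congr rfl fun j _ => ?_
      rw [Finset.sum_mul]
      refine Finset.sum_congr rfl fun i _ => ?_
      simp_rw [Finset.sum_mul]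
      refine Finset.sum_congr rfl fun d hd => ?_
      rw [Finset.mem_filter, Prod.mk.injEq] at hd
      have := hsum d hd.1
      rw [Fin.prod_univ_three, ← hd.2.1, ← hd.2.2]
      have e : D - d 1 - d 2 = d 0 := by omega
      simp [e, mul_assoc]
    · intro d hd
      have := hsum d hd
      simp only [Finset.mem_product, Finset.mem_range]
      omega

/-- The coefficient of `t ^ i` in `f (u + t v)`. -/
noncomputable def lineCoeff (f : MvPolynomial (Fin m) F) (u v : Fin m → F) (i : ℕ) : F :=
  (aeval (fun j => Polynomial.C (u j) + Polynomial.C (v j) * Polynomial.X) f).coeff i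

/-- The derivative of `f` at `w` in the direction `u`. -/
noncomputable def dirDeriv (f : MvPolynomial (Fin m) F) (w u : Fin m → F) : F :=
  ∑ i, u i * eval w (pderiv i f)

theorem dirDeriv_add (f : MvPolynomial (Fin m) F) (w u u' : Fin m → F) :
    dirDeriv f w (u + u') = dirDeriv f w u + dirDeriv f w u' := by
  simp [dirDeriv, add_mul, Finset.sum_add_distrib]

theorem dirDeriv_smul (f : MvPolynomial (Fin m) F) (w u : Fin m → F) (a : F) :
    dirDeriv f w (a • u) = a * dirDeriv f w u := by
  simp [dirDeriv, Finset.mul_sum, mul_assoc]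

theorem lineCoeff_one (f : MvPolynomial (Fin m) F) (u v : Fin m → F) :
    lineCoeff f u v 1 = dirDeriv f u v := by
  have key : ∀ f : MvPolynomial (Fin m) F,
      lineCoeff f u v 0 = eval u f ∧ lineCoeff f u v 1 = dirDeriv f u v := by
    intro f
    induction f using MvPolynomial.induction_on with
    | C a => simp [lineCoeff, dirDeriv, Polynomial.coeff_C]
    | add p q hp hq =>
      simp only [lineCoeff, dirDeriv, map_add, Polynomial.coeff_add, mul_add,
        Finset.sum_add_distrib] at hp hq ⊢
      rw [hp.1, hp.2, hq.1, hq.2]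
      exact ⟨rfl, rfl⟩
    | mul_X p i hp =>
      simp only [lineCoeff, dirDeriv, map_mul, aeval_X, eval_X, mul_add, Polynomial.coeff_add,
        ← mul_assoc, Polynomial.coeff_mul_C, Polynomial.coeff_mul_X, Polynomial.coeff_mul_X_zero,
        add_zero, Derivation.leibniz, pderiv_X, smul_eq_mul, map_add, Finset.sum_add_distrib,
        Pi.single_apply] at hp ⊢
      rw [hp.1, hp.2]
      refine ⟨rfl, ?_⟩
      have : ∀ x, eval u (if i = x then (1 : MvPolynomial (Fin m) F) else 0) =
        if i = x then 1 else 0 := fun x => by split_ifs <;> simp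
      simp only [this, mul_ite, mul_one, mul_zero, Finset.sum_ite_eq, Finset.mem_univ, if_true]
      rw [Finset.sum_mul, add_comm, mul_comm]
      congr 1
      exact Finset.sum_congr rfl fun x _ => by ring
  exact (key f).2

theorem IsHomogeneous.eval_smul' {f : MvPolynomial (Fin m) F} (hf : f.IsHomogeneous D)
    (a : F) (u : Fin m → F) :
    eval (a • u) f = a ^ D * eval u f := by
  rw [eval_eq', eval_eq', Finset.mul_sum]
  refine Finset.sum_congr rfl fun d hd => ?_
  have : ∑ i, d i = D := by
    rw [← Finsupp.degree_eq_sum, Finsupp.degree_apply]; exact (hf.degree_eq_sum_deg_support hd).symm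
  simp only [Pi.smul_apply, smul_eq_mul, mul_pow, Finset.prod_mul_distrib,
    Finset.prod_pow_eq_pow_sum,
    this]
  ring

theorem IsHomogeneous.eval_line {f : MvPolynomial (Fin m) F} (hf : f.IsHomogeneous D)
    (u v : Fin m → F) (t : F) :
    eval (u + t • v) f = ∑ i ∈ Finset.range (D + 1), lineCoeff f u v i * t ^ i := by
  have h1 : eval (u + t • v) f = Polynomial.eval t (MvPolynomial.aeval (fun j =>
      Polynomial.C (u j) + Polynomial.C (v j) * Polynomial.X) f) := by
    rw [← aeval_eq_eval, ← Polynomial.coe_aeval_eq_eval, ← AlgHom.coe_toRingHom, RingHom.coe_coe,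
      ← AlgHom.comp_apply, comp_aeval]
    congr 2
    funext i
    simp only [Pi.add_apply, Pi.smul_apply, smul_eq_mul, map_add, map_mul, Polynomial.aeval_C,
      Polynomial.aeval_X, Algebra.algebraMap_self, RingHom.id_apply, mul_comm t]
  rw [h1]
  refine Polynomial.eval_eq_sum_range' (Nat.lt_succ_iff.2 ?_) t
  refine (aeval_natDegree_le f hf.totalDegree_le _ fun i => ?_).trans
    (mul_one D).le
  compute_degree

theorem lineCoeff_zero (f : MvPolynomial (Fin m) F) (u v : Fin m → F) :
    lineCoeff f u v 0 = eval u f := by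
  rw [lineCoeff, Polynomial.coeff_zero_eq_eval_zero, ← Polynomial.coe_aeval_eq_eval,
    ← AlgHom.comp_apply, comp_aeval, ← aeval_eq_eval]
  simp

section FiniteField

variable [Fintype F]

theorem IsHomogeneous.lineCoeff_reverse {f : MvPolynomial (Fin m) F} (hf : f.IsHomogeneous D)
    (hD : D < Fintype.card F) (u v : Fin m → F) {i : ℕ} (hi : i ≤ D) :
    lineCoeff f v u i = lineCoeff f u v (D - i) := by
  obtain ⟨c, -, hc⟩ := hf.exists_coeff_three u v 0
  have h0 : ∀ a b : F, eval (a • u + b • v) f =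
      ∑ i ∈ Finset.range (D + 1), c i 0 * a ^ (D - i) * b ^ i := by
    intro a b
    have := hc a b 0
    rw [Finset.sum_eq_single_of_mem 0 (by simp) (fun j _ hj => by simp [hj])] at this
    simpa using this
  have h1 := coeff_eq_of_sum_eq hD (c := fun i => c i 0) (c' := lineCoeff f u v) fun t => by
    rw [← hf.eval_line]
    simpa using (h0 1 t).symm
  have h2 := coeff_eq_of_sum_eq hD (c := fun i => c (D - i) 0) (c' := lineCoeff f v u) fun t => by
    rw [← hf.eval_line, ← Finset.sum_range_reflect]
    have := h0 t 1
    rw [one_smul, add_comm] at this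
    rw [this]
    refine Finset.sum_congr rfl fun j hj => ?_
    have hj' : j ≤ D := Nat.lt_succ_iff.1 (Finset.mem_range.1 hj)
    have e : D - (D + 1 - 1 - j) = j := by omega
    rw [e, one_pow, mul_one, Nat.add_sub_cancel]
  rw [← h2 i hi, ← h1 _ (Nat.sub_le _ _)]

theorem IsHomogeneous.lineCoeff_self {f : MvPolynomial (Fin m) F} (hf : f.IsHomogeneous D)
    (hD : D < Fintype.card F) (u v : Fin m → F) : lineCoeff f u v D = eval v f := by
  rw [← lineCoeff_zero f v u, hf.lineCoeff_reverse hD u v (Nat.zero_le _), Nat.sub_zero]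

theorem IsHomogeneous.lineCoeff_smul {f : MvPolynomial (Fin m) F} (hf : f.IsHomogeneous D)
    (hD : D < Fintype.card F) (u v : Fin m → F) (a : F) {i : ℕ} (hi : i ≤ D) :
    lineCoeff f u (a • v) i = a ^ i * lineCoeff f u v i := by
  refine coeff_eq_of_sum_eq hD (c' := fun i => a ^ i * lineCoeff f u v i) (fun t => ?_) i hi
  rw [← hf.eval_line, smul_smul, hf.eval_line]
  exact Finset.sum_congr rfl fun j _ => by ring

/-- The coefficient of `t ^ s` in `f (u + t w)`, for `f` of degree `s + 1`, is linear in `u`. -/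
theorem IsHomogeneous.lineCoeff_pred {s : ℕ} {f : MvPolynomial (Fin m) F}
    (hf : f.IsHomogeneous (s + 1)) (hD : s + 1 < Fintype.card F) (u w : Fin m → F) :
    lineCoeff f u w s = dirDeriv f w u := by
  rw [← lineCoeff_one, hf.lineCoeff_reverse hD w u (Nat.le_succ s), Nat.add_sub_cancel_left]

theorem IsHomogeneous.dirDeriv_smul_left {s : ℕ} {f : MvPolynomial (Fin m) F}
    (hf : f.IsHomogeneous (s + 1)) (hD : s + 1 < Fintype.card F) (w u : Fin m → F) (a : F) :
    dirDeriv f (a • w) u = a ^ s * dirDeriv f w u := by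
  rw [← hf.lineCoeff_pred hD, ← hf.lineCoeff_pred hD, hf.lineCoeff_smul hD _ _ _ (Nat.le_succ s)]

end FiniteField

end MvPolynomial

namespace Polynomial

variable {F : Type*} [Field F]

/-- A bivariate polynomial has total degree at most `N`. -/
def TotalDegreeLE (N : ℕ) (h : F[X][X]) : Prop :=
  ∀ i j, N < i + j → (h.coeff j).coeff i = 0

theorem TotalDegreeLE.mul {a b : ℕ} {g h : F[X][X]} (hg : TotalDegreeLE a g)
    (hh : TotalDegreeLE b h) : TotalDegreeLE (a + b) (g * h) := by
  intro i j hij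
  rw [coeff_mul, finsetSum_coeff]
  refine Finset.sum_eq_zero fun x hx => ?_
  rw [coeff_mul]
  refine Finset.sum_eq_zero fun y hy => ?_
  rw [Finset.HasAntidiagonal.mem_antidiagonal] at hx hy
  by_cases h1 : a < y.1 + x.1
  · rw [hg _ _ h1, zero_mul]
  · rw [hh _ _ (by omega), mul_zero]

theorem TotalDegreeLE.sub {a : ℕ} {g h : F[X][X]} (hg : TotalDegreeLE a g)
    (hh : TotalDegreeLE a h) : TotalDegreeLE a (g - h) := by
  intro i j hij
  simp [hg i j hij, hh i j hij]

/-- Division of a power of the outer variable by a monic polynomial does not increase the total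
degree. -/
theorem exists_X_pow_eq_mul_add {s : ℕ} (hs : 1 ≤ s) {g : F[X][X]} (hg : g.Monic)
    (hgs : g.natDegree = s) (hgt : TotalDegreeLE s g) (N : ℕ) :
    ∃ Q r : F[X][X], X ^ N = g * Q + r ∧ (∀ j, s ≤ j → r.coeff j = 0) ∧ TotalDegreeLE N r := by
  induction N with
  | zero =>
    refine ⟨0, 1, by simp, fun j hj => ?_, fun i j hij => ?_⟩
    · rw [coeff_one, if_neg (by omega)]
    · rw [coeff_one]
      split_ifs with h
      · rw [coeff_one, if_neg (by omega)]
      · simp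
  | succ N ih =>
    obtain ⟨Q, r, hQ, hr, hrt⟩ := ih
    have hc : TotalDegreeLE (N - (s - 1)) (C (r.coeff (s - 1))) := by
      intro i j hij
      rw [coeff_C]
      split_ifs with h
      · subst h
        exact hrt _ _ (by omega)
      · simp
    have hc' : N < s - 1 → r.coeff (s - 1) = 0 := fun h => by
      ext i
      simpa using hrt i (s - 1) (by omega)
    refine ⟨X * Q + C (r.coeff (s - 1)), r * X - C (r.coeff (s - 1)) * g, ?_, ?_, ?_⟩
    · rw [pow_succ, hQ]; ring
    · intro j hj
      obtain ⟨j, rfl⟩ : ∃ j', j = j' + 1 := ⟨j - 1, by omega⟩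
      rw [coeff_sub, coeff_mul_X, coeff_C_mul]
      rcases hj.eq_or_lt with h | h
      · have h1 : g.coeff (j + 1) = 1 := by
          rw [← h, ← hgs]; exact hg
        have h2 : s - 1 = j := by omega
        rw [h1, h2, mul_one, sub_self]
      · rw [hr j (by omega), coeff_eq_zero_of_natDegree_lt (p := g) (by omega), mul_zero, sub_zero]
    · refine TotalDegreeLE.sub ?_ ?_
      · refine hrt.mul fun i j hij => ?_
        rw [coeff_X]
        split_ifs with h
        · rw [coeff_one, if_neg (by omega)]
        · simp
      · by_cases h : N < s - 1
        · rw [hc' h]; intro i j _; simp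
        · have := hc.mul hgt
          rwa [show N - (s - 1) + s = N + 1 by omega] at this

variable [Fintype F]

/-- If every specialisation of a monic bivariate polynomial of total degree `s` divides
`X ^ q - X`, then it depends on a single linear form only. -/
theorem exists_eval_eq_eval_sub_mul {s : ℕ} (hs : 2 ≤ s) (hsq : s < Fintype.card F) {g : F[X][X]}
    (hg : g.Monic) (hgs : g.natDegree = s) (hgt : TotalDegreeLE s g)
    (hdvd : ∀ a : F, g.map (evalRingHom a) ∣ X ^ Fintype.card F - X) :
    ∃ α : F, ∀ a t : F,
      (g.map (evalRingHom a)).eval t = (g.map (evalRingHom 0)).eval (t - α * a) := by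
  classical
  set q := Fintype.card F with hq
  obtain ⟨Q, r, hQ, hr, hrt⟩ := exists_X_pow_eq_mul_add (by omega) hg hgs hgt q
  have hvan : ∀ (a : F) (j : ℕ), (r.coeff j).eval a = if j = 1 then 1 else 0 := by
    intro a j
    have hd : g.map (evalRingHom a) ∣ r.map (evalRingHom a) - X := by
      have h1 : (X : F[X]) ^ q = g.map (evalRingHom a) * Q.map (evalRingHom a) +
          r.map (evalRingHom a) := by
        have := congrArg (map (evalRingHom a)) hQ
        simpa using this
      have h2 : r.map (evalRingHom a) - X =
          X ^ q - X - g.map (evalRingHom a) * Q.map (evalRingHom a) := by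
        rw [h1]; ring
      rw [h2]
      exact dvd_sub (hdvd a) (dvd_mul_right _ _)
    have h0 : r.map (evalRingHom a) - X = 0 := by
      refine eq_zero_of_dvd_of_natDegree_lt hd ?_
      rw [hg.natDegree_map, hgs]
      refine lt_of_le_of_lt (b := s - 1) (natDegree_le_iff_coeff_eq_zero.2 fun N hN => ?_)
        (by omega)
      rw [coeff_sub, coeff_map, hr N (by omega), coeff_X, if_neg (by omega)]
      simp
    have := congrArg (fun p => coeff p j) (sub_eq_zero.1 h0)
    simpa [coeff_X, eq_comm (a := 1)] using this
  have hzero : ∀ p : F[X], p.natDegree < q → (∀ a, p.eval a = 0) → p = 0 := fun p hp h =>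
    eq_zero_of_natDegree_lt_card_of_eval_eq_zero p Function.injective_id h hp
  have hpos : ∀ j, j ≠ 0 → r.coeff j = if j = 1 then 1 else 0 := by
    intro j hj
    rw [← sub_eq_zero]
    refine hzero _ ?_ fun a => ?_
    · refine lt_of_le_of_lt (b := q - 1) (natDegree_le_iff_coeff_eq_zero.2 fun N hN => ?_)
        (by omega)
      rw [coeff_sub, hrt N j (by omega)]
      split_ifs
      · rw [coeff_one, if_neg (by omega), sub_zero]
      · simp
    · rw [eval_sub, hvan]
      split_ifs <;> simp
  set β := (r.coeff 0).coeff q with hβ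
  have hcoeff0 : r.coeff 0 = C β * (X ^ q - X) := by
    rw [← sub_eq_zero]
    refine hzero _ ?_ fun a => ?_
    · refine lt_of_le_of_lt (b := q - 1) (natDegree_le_iff_coeff_eq_zero.2 fun N hN => ?_)
        (by omega)
      rw [coeff_sub, coeff_C_mul, coeff_sub, coeff_X_pow, coeff_X, if_neg (by omega : 1 ≠ N)]
      split_ifs with h
      · rw [h]; simp [hβ]
      · rw [hrt N 0 (by omega)]; simp
    · simp [hvan, FiniteField.pow_card, hq]
  have hrX : r = X + C (C β * (X ^ q - X)) := by
    ext1 j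
    rcases eq_or_ne j 0 with rfl | hj
    · rw [hcoeff0, coeff_add, coeff_C_zero, coeff_X_zero, zero_add]
    · rw [hpos j hj, coeff_add, coeff_C, if_neg hj, coeff_X, add_zero]
      simp [eq_comm (a := 1)]
  set L : F[X][X] := X + C (C β * X) with hL
  have hLq : L ^ q = X ^ q + C (C β * X ^ q) := by
    obtain ⟨p, hp⟩ := CharP.exists F
    have := hp
    obtain ⟨n, hpp, hn⟩ := FiniteField.card F p
    have : Fact p.Prime := ⟨hpp⟩
    rw [hL, hq, hn, add_pow_char_pow, ← hn, ← C_pow, mul_pow, ← C_pow, FiniteField.pow_card]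
  have hprod : g.comp L * Q.comp L = C (C 1) * (X ^ q - X) := by
    have h1 := congrArg (fun p => comp p L) hQ
    simp only [hrX, pow_comp, X_comp, add_comp, mul_comp, C_comp, hLq] at h1
    have h2 : g.comp L * Q.comp L = X ^ q + C (C β * X ^ q) - (L + C (C β * (X ^ q - X))) := by
      rw [h1]; ring
    rw [h2, hL]
    simp only [C_mul, C_sub, map_one]
    ring
  have hswap : Bivariate.swap (g.comp L) * Bivariate.swap (Q.comp L) = C (X ^ q - X : F[X]) := by
    rw [← map_mul, hprod]
    simp only [map_mul, map_sub, map_pow, Bivariate.swap_Y, Bivariate.swap_C_C]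
    simp
  have hne : (X ^ q - X : F[X]) ≠ 0 := FiniteField.X_pow_card_sub_X_ne_zero F (by omega)
  have hnd : (Bivariate.swap (g.comp L)).natDegree = 0 := by
    have h3 : Bivariate.swap (g.comp L) * Bivariate.swap (Q.comp L) ≠ 0 := by
      rw [hswap]; exact C_ne_zero.2 hne
    have h4 := natDegree_mul (left_ne_zero_of_mul h3) (right_ne_zero_of_mul h3)
    rw [hswap, natDegree_C] at h4
    omega
  obtain ⟨h, hh⟩ := natDegree_eq_zero.1 hnd
  have hgL : g.comp L = h.map C := by
    rw [← Bivariate.swap_swap_apply (g.comp L), ← hh, Bivariate.swap_C]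
  have hev : ∀ a t : F, (g.map (evalRingHom a)).eval t = h.eval (t - β * a) := by
    intro a t
    have h5 := congrArg (fun p => (p.map (evalRingHom a)).eval (t - β * a)) hgL
    have h6 : (evalRingHom a).comp C = RingHom.id F := by ext; simp
    have h7 : L.map (evalRingHom a) = X + C (β * a) := by simp [hL]
    simpa only [map_comp, h7, eval_comp, eval_add, eval_X, eval_C, sub_add_cancel, map_map, h6,
      map_id] using h5
  refine ⟨β, fun a t => ?_⟩
  rw [hev, hev]
  simp

end Polynomial

open MvPolynomial (eval lineCoeff dirDeriv lineCoeff_one lineCoeff_zero dirDeriv_add dirDeriv_smul)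

section FrobeniusPower

variable {F : Type*} [Field F] [Fintype F] {s : ℕ}

theorem two_le_of_card_eq_sq (hq : Fintype.card F = s ^ 2) : 2 ≤ s := by
  have := Fintype.one_lt_card (α := F)
  by_contra h
  interval_cases s <;> omega

theorem succ_lt_card_of_card_eq_sq (hq : Fintype.card F = s ^ 2) : s + 1 < Fintype.card F := by
  have := two_le_of_card_eq_sq hq
  nlinarith

theorem pow_pow_of_card_eq_sq (hq : Fintype.card F = s ^ 2) (a : F) : (a ^ s) ^ s = a := by
  rw [← pow_mul, ← sq, ← hq, FiniteField.pow_card]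

/-- The map `a ↦ a ^ s` on a field with `s ^ 2` elements. -/
theorem exists_ringHom_pow_of_card_eq_sq (hq : Fintype.card F = s ^ 2) :
    ∃ σ : F →+* F, ∀ a, σ a = a ^ s := by
  obtain ⟨p, hp⟩ := CharP.exists F
  obtain ⟨n, hpp, hn⟩ := FiniteField.card F p
  have : Fact p.Prime := ⟨hpp⟩
  have h1 : s ∣ p ^ (n : ℕ) := by
    rw [← hn, hq]; exact dvd_pow_self s two_ne_zero
  obtain ⟨k, -, rfl⟩ := (Nat.dvd_prime_pow hpp).1 h1
  exact ⟨iterateFrobenius F p k, fun a => iterateFrobenius_def p k a⟩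

theorem add_pow_of_card_eq_sq (hq : Fintype.card F = s ^ 2) (a b : F) :
    (a + b) ^ s = a ^ s + b ^ s := by
  obtain ⟨σ, hσ⟩ := exists_ringHom_pow_of_card_eq_sq hq
  rw [← hσ, map_add, hσ, hσ]

theorem sub_pow_of_card_eq_sq (hq : Fintype.card F = s ^ 2) (a b : F) :
    (a - b) ^ s = a ^ s - b ^ s := by
  obtain ⟨σ, hσ⟩ := exists_ringHom_pow_of_card_eq_sq hq
  rw [← hσ, map_sub, hσ, hσ]

theorem neg_pow_of_card_eq_sq (hq : Fintype.card F = s ^ 2) (a : F) : (-a) ^ s = -a ^ s := by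
  obtain ⟨σ, hσ⟩ := exists_ringHom_pow_of_card_eq_sq hq
  rw [← hσ, map_neg, hσ]

end FrobeniusPower

open Polynomial in
/-- A monic polynomial with as many roots in a finite field as its degree divides `X ^ q - X`. -/
theorem Polynomial.Monic.dvd_X_pow_card_sub_X {F : Type*} [Field F] [Fintype F] [DecidableEq F]
    {g : F[X]} (hg : g.Monic)
    (h : g.natDegree ≤ (Finset.univ.filter fun t : F => g.eval t = 0).card) :
    g ∣ X ^ Fintype.card F - X := by
  set S := Finset.univ.filter fun t : F => g.eval t = 0 with hS
  have hdvd : ∏ t ∈ S, (X - C t) ∣ g :=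
    Finset.prod_dvd_of_coprime (fun a _ b _ hab => (isCoprime_X_sub_C_of_isUnit_sub
      (sub_ne_zero.2 hab).isUnit)) fun t ht => dvd_iff_isRoot.2 (by simpa [hS] using ht)
  have hmon : (∏ t ∈ S, (X - C t)).Monic := monic_prod_of_monic _ _ fun t _ => monic_X_sub_C t
  have hdeg : (∏ t ∈ S, (X - C t)).natDegree = S.card := by
    rw [natDegree_prod_of_monic _ _ fun t _ => monic_X_sub_C t]
    simp
  have heq : g = ∏ t ∈ S, (X - C t) :=
    Polynomial.eq_of_monic_of_dvd_of_natDegree_le hmon hg hdvd (by rw [hdeg]; exact h)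
  rw [heq]
  refine Finset.prod_dvd_of_coprime (fun a _ b _ hab => (isCoprime_X_sub_C_of_isUnit_sub
      (sub_ne_zero.2 hab).isUnit)) fun t _ => dvd_iff_isRoot.2 ?_
  simp [FiniteField.pow_card]

theorem MvPolynomial.IsHomogeneous.dirDeriv_eq_zero_of_mem {F : Type*} [Field F] [Fintype F]
    {m s : ℕ} {f : MvPolynomial (Fin m) F} (hf : f.IsHomogeneous (s + 1))
    (hs : s + 1 < Fintype.card F) {W : Submodule F (Fin m → F)} (hW : ∀ w ∈ W, eval w f = 0)
    {v w : Fin m → F} (hv : v ∈ W) (hw : w ∈ W) : dirDeriv f v w = 0 := by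
  rw [← lineCoeff_one]
  refine coeff_eq_of_sum_eq hs (c' := 0) (fun t => ?_) 1 (by omega)
  rw [← hf.eval_line, hW _ (W.add_mem hv (W.smul_mem t hw))]
  simp

/-- `W` is a linear space on which the form `f` vanishes, and every affine translate of `W`
outside `W` contains the largest possible number of zeros of `f`. -/
structure IsExtremalSubspace {F : Type*} [Field F] [Fintype F] [DecidableEq F] {m : ℕ} (s : ℕ)
    (f : MvPolynomial (Fin m) F) (W : Submodule F (Fin m → F)) : Prop where
  card_eq : Fintype.card F = s ^ 2
  isHomogeneous : f.IsHomogeneous (s + 1)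
  eval_eq_zero : ∀ w ∈ W, eval w f = 0
  exists_dirDeriv_ne_zero : ∀ u ∉ W, ∃ v ∈ W, dirDeriv f v u ≠ 0
  le_card_roots : ∀ u ∉ W, ∀ v ∈ W, dirDeriv f v u ≠ 0 →
    s ≤ (Finset.univ.filter fun t : F => eval (u + t • v) f = 0).card

namespace IsExtremalSubspace

variable {F : Type*} [Field F] [Fintype F] [DecidableEq F] {m s : ℕ}
  {f : MvPolynomial (Fin m) F} {W : Submodule F (Fin m → F)}

theorem dirDeriv_eq_zero (h : IsExtremalSubspace s f W) {v w : Fin m → F} (hv : v ∈ W)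
    (hw : w ∈ W) : dirDeriv f v w = 0 :=
  h.isHomogeneous.dirDeriv_eq_zero_of_mem (succ_lt_card_of_card_eq_sq h.card_eq) h.eval_eq_zero
    hv hw

theorem dirDeriv_add_mem (h : IsExtremalSubspace s f W) (u : Fin m → F) {v w : Fin m → F}
    (hv : v ∈ W) (hw : w ∈ W) : dirDeriv f v (u + w) = dirDeriv f v u := by
  rw [dirDeriv_add, h.dirDeriv_eq_zero hv hw, add_zero]

open Polynomial in
/-- On every plane of an extremal coset which contains a direction of maximal degree, `f` depends
only on a single linear form. -/
theorem exists_eval_add_smul_add_smul (h : IsExtremalSubspace s f W) {u v w : Fin m → F}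
    (hu : u ∉ W) (hv : v ∈ W) (hw : w ∈ W) (huv : dirDeriv f v u ≠ 0) :
    ∃ α : F, ∀ a t : F,
      MvPolynomial.eval (u + a • w + t • v) f = MvPolynomial.eval (u + (t - α * a) • v) f := by
  have hs := two_le_of_card_eq_sq h.card_eq
  have hq := succ_lt_card_of_card_eq_sq h.card_eq
  obtain ⟨c, hc0, hc⟩ := h.isHomogeneous.exists_coeff_three u w v
  have hctop : ∀ i j, s < i + j → c i j = 0 := by
    intro i j hij
    rcases (Nat.succ_le_iff.2 hij).eq_or_lt with hij | hij
    · have := coeff_eq_of_sum_eq hq (c := fun j => c (s + 1 - j) j) (c' := 0) (fun t => ?_) j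
        (by omega)
      · simpa [show s + 1 - j = i by omega] using this
      · have h1 := hc 0 1 t
        rw [zero_smul, zero_add, one_smul,
          h.eval_eq_zero _ (W.add_mem hw (W.smul_mem t hv))] at h1
        simp only [Pi.zero_apply, zero_mul, Finset.sum_const_zero]
        rw [h1]
        refine Finset.sum_congr rfl fun j hj => ?_
        rw [Finset.sum_eq_single_of_mem (s + 1 - j) (Finset.mem_range.2 (by omega))]
        · simp [show s + 1 - (s + 1 - j) - j = 0 by omega]
        · intro i _ hi
          rcases lt_or_gt_of_ne hi with hi | hi
          · rw [zero_pow (by omega)]; simp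
          · rw [hc0 i j (by omega)]; simp
    · exact hc0 i j (by omega)
  set b := dirDeriv f v u with hb
  have hcs : c 0 s = b := by
    have := coeff_eq_of_sum_eq hq (c := fun j => c 0 j) (c' := lineCoeff f u v) (fun t => ?_) s
      (by omega)
    · rw [this, h.isHomogeneous.lineCoeff_pred hq]
    · rw [← h.isHomogeneous.eval_line]
      have h1 := hc 1 0 t
      rw [zero_smul, one_smul, add_zero] at h1
      rw [h1]
      refine Finset.sum_congr rfl fun j _ => ?_
      rw [Finset.sum_eq_single_of_mem 0 (by simp) fun i _ hi => by simp [hi]]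
      simp
  set g : F[X][X] := ∑ j ∈ Finset.range (s + 2),
    C (∑ i ∈ Finset.range (s + 2), C (b⁻¹ * c i j) * X ^ i) * X ^ j with hgdef
  have hcoeff : ∀ i j, (g.coeff j).coeff i = b⁻¹ * c i j := by
    intro i j
    have hz : (i < s + 2 ∧ j < s + 2) ∨ c i j = 0 := by
      by_cases hij : s < i + j
      · exact Or.inr (hctop i j hij)
      · exact Or.inl (by omega)
    rw [hgdef, finsetSum_coeff]
    simp only [coeff_C_mul_X_pow, Finset.sum_ite_eq, Finset.mem_range]
    split_ifs with h1
    · simp only [finsetSum_coeff, coeff_C_mul_X_pow, Finset.sum_ite_eq, Finset.mem_range]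
      split_ifs with h2
      · rfl
      · rw [hz.resolve_left (by omega), mul_zero]
    · rw [hz.resolve_left (by omega), mul_zero, coeff_zero]
  have hgt : TotalDegreeLE s g := fun i j hij => by rw [hcoeff, hctop i j hij, mul_zero]
  have hgle : g.natDegree ≤ s := natDegree_le_iff_coeff_eq_zero.2 fun N hN => by
    ext i; rw [hgt i N (by omega), coeff_zero]
  have hgs1 : g.coeff s = 1 := by
    ext i
    rw [coeff_one]
    split_ifs with hi
    · rw [hi, hcoeff, hcs, inv_mul_cancel₀ huv]
    · exact hgt i s (by omega)
  have hgm : g.Monic := monic_of_natDegree_le_of_coeff_eq_one s hgle hgs1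
  have hgs : g.natDegree = s :=
    le_antisymm hgle (le_natDegree_of_ne_zero (by rw [hgs1]; exact one_ne_zero))
  have hev : ∀ a t : F, (g.map (evalRingHom a)).eval t =
      b⁻¹ * MvPolynomial.eval (u + a • w + t • v) f := by
    intro a t
    have h1 := hc 1 a t
    rw [one_smul] at h1
    rw [h1, hgdef]
    simp [Polynomial.map_sum, eval_finsetSum, Finset.mul_sum, Finset.sum_mul, mul_assoc]
  obtain ⟨α, hα⟩ := exists_eval_eq_eval_sub_mul hs (by omega) hgm hgs hgt fun a => by
    refine (hgm.map _).dvd_X_pow_card_sub_X ?_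
    rw [hgm.natDegree_map, hgs]
    have haw : u + a • w ∉ W := fun h' => hu (by simpa using W.sub_mem h' (W.smul_mem a hw))
    refine (h.le_card_roots _ haw v hv ?_).trans (Finset.card_le_card fun t ht => ?_)
    · rwa [h.dirDeriv_add_mem u hv (W.smul_mem a hw)]
    · simp only [Finset.mem_filter, Finset.mem_univ, true_and] at ht ⊢
      rw [hev, ht, mul_zero]
  refine ⟨α, fun a t => mul_left_cancel₀ (inv_ne_zero huv) ?_⟩
  rw [← hev, hα, hev, zero_smul, add_zero]

theorem exists_dirDeriv_eq_one (h : IsExtremalSubspace s f W) {u : Fin m → F} (hu : u ∉ W) :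
    ∃ v ∈ W, dirDeriv f v u = 1 := by
  obtain ⟨v, hv, hvu⟩ := h.exists_dirDeriv_ne_zero u hu
  refine ⟨((dirDeriv f v u)⁻¹ ^ s) • v, W.smul_mem _ hv, ?_⟩
  rw [h.isHomogeneous.dirDeriv_smul_left (succ_lt_card_of_card_eq_sq h.card_eq),
    pow_pow_of_card_eq_sq h.card_eq, inv_mul_cancel₀ hvu]

theorem eval_add_smul (h : IsExtremalSubspace s f W) {u v w : Fin m → F} (hu : u ∉ W)
    (hv : v ∈ W) (hw : w ∈ W) (huv : dirDeriv f v u = 1) (a : F) :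
    eval (u + a • w) f = eval (u + (a * dirDeriv f w u ^ s) • v) f := by
  have hs := two_le_of_card_eq_sq h.card_eq
  have hq := succ_lt_card_of_card_eq_sq h.card_eq
  obtain ⟨α, hα⟩ := h.exists_eval_add_smul_add_smul hu hv hw (by rw [huv]; exact one_ne_zero)
  have h1 : ∀ a : F, eval (u + a • w) f = eval (u + a • ((-α) • v)) f := fun a => by
    have := hα a 0
    rw [zero_smul, add_zero] at this
    rw [this, smul_smul]
    congr 4; ring
  have h2 : dirDeriv f w u = (-α) ^ s := by
    have := coeff_eq_of_sum_eq hq (c := lineCoeff f u w) (c' := lineCoeff f u ((-α) • v))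
      (fun t => by rw [← h.isHomogeneous.eval_line, ← h.isHomogeneous.eval_line, h1]) s (by omega)
    rwa [h.isHomogeneous.lineCoeff_pred hq, h.isHomogeneous.lineCoeff_pred hq,
      h.isHomogeneous.dirDeriv_smul_left hq, huv, mul_one] at this
  rw [h1, h2, pow_pow_of_card_eq_sq h.card_eq, smul_smul]

theorem dirDeriv_add_left (h : IsExtremalSubspace s f W) (u : Fin m → F) {w w' : Fin m → F}
    (hw : w ∈ W) (hw' : w' ∈ W) :
    dirDeriv f (w + w') u = dirDeriv f w u + dirDeriv f w' u := by
  have hs := two_le_of_card_eq_sq h.card_eq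
  have hq := succ_lt_card_of_card_eq_sq h.card_eq
  by_cases hu : u ∈ W
  · rw [h.dirDeriv_eq_zero (W.add_mem hw hw') hu, h.dirDeriv_eq_zero hw hu,
      h.dirDeriv_eq_zero hw' hu, add_zero]
  obtain ⟨v, hv, hvu⟩ := h.exists_dirDeriv_eq_one hu
  have h1 : ∀ a : F, eval (u + a • (w + w')) f =
      eval (u + a • ((dirDeriv f w u ^ s + dirDeriv f w' u ^ s) • v)) f := by
    intro a
    have hmem : ∀ z ∈ W, u + z ∉ W := fun z hz h' => hu (by simpa using W.sub_mem h' hz)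
    have e1 : u + a • (w + w') = (u + a • w') + a • w := by module
    have e2 : u + a • w' + (a * dirDeriv f w u ^ s) • v =
      u + (a * dirDeriv f w u ^ s) • v + a • w' := by module
    have hd : ∀ {x z : Fin m → F}, x ∈ W → z ∈ W → dirDeriv f x (u + z) = dirDeriv f x u :=
      fun hx hz => h.dirDeriv_add_mem u hx hz
    rw [e1, h.eval_add_smul (hmem _ (W.smul_mem a hw')) hv hw
      (by rw [hd hv (W.smul_mem a hw'), hvu]), hd hw (W.smul_mem a hw'), e2,
      h.eval_add_smul (hmem _ (W.smul_mem _ hv)) hv hw' (by rw [hd hv (W.smul_mem _ hv), hvu]),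
      hd hw' (W.smul_mem _ hv)]
    congr 2
    module
  have := coeff_eq_of_sum_eq hq (c := lineCoeff f u (w + w')) (c' := lineCoeff f u
    ((dirDeriv f w u ^ s + dirDeriv f w' u ^ s) • v))
    (fun t => by rw [← h.isHomogeneous.eval_line, ← h.isHomogeneous.eval_line, h1]) s (by omega)
  rwa [h.isHomogeneous.lineCoeff_pred hq, h.isHomogeneous.lineCoeff_pred hq,
    h.isHomogeneous.dirDeriv_smul_left hq, hvu, mul_one, add_pow_of_card_eq_sq h.card_eq,
    pow_pow_of_card_eq_sq h.card_eq, pow_pow_of_card_eq_sq h.card_eq] at this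

theorem exists_lineCoeff_eq (h : IsExtremalSubspace s f W) {u : Fin m → F} (hu : u ∉ W) :
    ∃ p : ℕ → F, ∀ w ∈ W, ∀ i ≤ s + 1, lineCoeff f u w i = p i * dirDeriv f w u ^ (s * i) := by
  have hq := succ_lt_card_of_card_eq_sq h.card_eq
  obtain ⟨v, hv, hvu⟩ := h.exists_dirDeriv_eq_one hu
  refine ⟨lineCoeff f u v, fun w hw i hi => ?_⟩
  have := coeff_eq_of_sum_eq hq (c := lineCoeff f u w)
    (c' := lineCoeff f u ((dirDeriv f w u ^ s) • v)) (fun t => by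
      rw [← h.isHomogeneous.eval_line, ← h.isHomogeneous.eval_line, h.eval_add_smul hu hv hw hvu,
        smul_smul]) i hi
  rw [this, h.isHomogeneous.lineCoeff_smul hq _ _ _ hi, pow_mul, mul_comm]

end IsExtremalSubspace

theorem MvPolynomial.totalDegree_le_of_homogeneousComponent_eq_zero {F σ : Type*} [Field F] {N : ℕ}
    {p : MvPolynomial σ F} (hp : p.totalDegree ≤ N + 1)
    (h : homogeneousComponent (N + 1) p = 0) : p.totalDegree ≤ N := by
  refine Finset.sup_le fun d hd => ?_
  have h1 : d.degree ≤ N + 1 := (le_totalDegree hd).trans hp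
  rcases h1.eq_or_lt with h1 | h1
  · have := congrArg (coeff d) h
    rw [coeff_homogeneousComponent, if_pos h1, coeff_zero] at this
    exact absurd this (mem_support_iff.1 hd)
  · exact Nat.lt_succ_iff.1 h1

theorem MvPolynomial.totalDegree_aeval_le {F σ τ : Type*} [Field F] {N : ℕ} {f : MvPolynomial σ F}
    (hf : f.totalDegree ≤ N) {g : σ → MvPolynomial τ F} (hg : ∀ i, (g i).totalDegree ≤ 1) :
    (MvPolynomial.aeval g f).totalDegree ≤ N := by
  rw [MvPolynomial.aeval_def, eval₂_eq, MvPolynomial.algebraMap_eq]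
  refine totalDegree_finsetSum_le fun d hd => ?_
  refine (totalDegree_mul _ _).trans ?_
  rw [totalDegree_C, zero_add]
  refine (totalDegree_finsetProd _ _).trans (le_trans ?_ ((le_totalDegree hd).trans hf))
  exact Finset.sum_le_sum fun i _ => (totalDegree_pow _ _).trans
    ((Nat.mul_le_mul_left _ (hg i)).trans (mul_one _).le)

section Counting

variable {F : Type*} [Field F] [Fintype F] [DecidableEq F] {m s k : ℕ}
  {f : MvPolynomial (Fin m) F} {W : Submodule F (Fin m → F)} [DecidablePred (· ∈ W)]

theorem MvPolynomial.IsHomogeneous.card_zeros_eq {D : ℕ} (hf : f.IsHomogeneous D) (hD : D ≠ 0) :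
    (Finset.univ.filter fun v : Fin m → F => eval v f = 0).card =
      numPoints f * (Fintype.card F - 1) + 1 := by
  let φ : {p : Projectivization F (Fin m → F) // eval p.rep f = 0} × Fˣ →
      {v : Fin m → F // v ≠ 0 ∧ eval v f = 0} := fun x =>
    ⟨(x.2 : F) • x.1.1.rep, smul_ne_zero x.2.ne_zero x.1.1.rep_nonzero, by
      rw [hf.eval_smul', x.1.2, mul_zero]⟩
  have hφ : Function.Bijective φ := by
    constructor
    · rintro ⟨⟨p, hp⟩, a⟩ ⟨⟨p', hp'⟩, b⟩ h
      have h1 : (a : F) • p.rep = (b : F) • p'.rep := congrArg Subtype.val h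
      have hpp : p = p' := by
        rw [← p.mk_rep, ← p'.mk_rep, Projectivization.mk_eq_mk_iff]
        refine ⟨a⁻¹ * b, ?_⟩
        rw [mul_smul, inv_smul_eq_iff]
        exact h1.symm
      subst hpp
      have := Units.ext (smul_left_injective F p.rep_nonzero h1)
      simp [this]
    · rintro ⟨v, hv, hv0⟩
      obtain ⟨a, ha⟩ := Projectivization.exists_smul_eq_mk_rep F v hv
      have ha' : (a : F) • v = (Projectivization.mk F v hv).rep := ha
      refine ⟨(⟨Projectivization.mk F v hv, ?_⟩, a⁻¹), ?_⟩
      · rw [← ha', hf.eval_smul', hv0, mul_zero]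
      · refine Subtype.ext ?_
        change ((a⁻¹ : Fˣ) : F) • (Projectivization.mk F v hv).rep = v
        rw [← ha', smul_smul, Units.inv_mul, one_smul]
  have h0 : eval (0 : Fin m → F) f = 0 := by
    have := hf.eval_smul' 0 0
    rwa [zero_smul, zero_pow hD, zero_mul] at this
  have h1 := Nat.card_congr (Equiv.ofBijective φ hφ)
  rw [Nat.card_prod, Nat.card_eq_fintype_card (α := Fˣ), Fintype.card_units,
    Nat.card_eq_fintype_card (α := {v : Fin m → F // v ≠ 0 ∧ eval v f = 0}),
    Fintype.card_subtype] at h1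
  rw [numPoints, h1, ← Finset.card_insert_of_notMem (a := (0 : Fin m → F)) (by simp)]
  congr 1
  ext v
  by_cases hv : v = 0
  · subst hv
    simpa using h0
  · simp [hv]

theorem MvPolynomial.card_zeros_le {r N : ℕ} {p : MvPolynomial (Fin (r + 1)) F} (hp : p ≠ 0)
    (hN : p.totalDegree ≤ N) :
    (Finset.univ.filter fun x : Fin (r + 1) → F => eval x p = 0).card ≤
      N * Fintype.card F ^ r := by
  have h := schwartz_zippel_totalDegree hp (Finset.univ : Finset F)
  rw [Fintype.piFinset_univ, Finset.card_univ] at h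
  have hq : (0 : ℚ≥0) < Fintype.card F := by exact_mod_cast Fintype.card_pos
  rw [div_le_div_iff₀ (by positivity) hq, pow_succ, ← mul_assoc, mul_le_mul_iff_left₀ hq] at h
  have h' := (show _ ≤ _ by exact_mod_cast h :
    (Finset.univ.filter fun x : Fin (r + 1) → F => eval x p = 0).card ≤
      p.totalDegree * Fintype.card F ^ r)
  exact h'.trans (Nat.mul_le_mul_right _ hN)

/-- The number of zeros of `f` on an affine translate of a linear space on which `f` vanishes. -/
theorem MvPolynomial.IsHomogeneous.card_zeros_coset_le (hf : f.IsHomogeneous (s + 1))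
    (hs : 0 < s) (hq : s + 1 < Fintype.card F) (hW : ∀ w ∈ W, eval w f = 0)
    (hk : Module.finrank F W = k + 1) {u : Fin m → F} (hu : ∃ w ∈ W, eval (u + w) f ≠ 0) :
    (Finset.univ.filter fun w : W => eval (u + (w : Fin m → F)) f = 0).card ≤
        s * Fintype.card F ^ k ∧
      (s * Fintype.card F ^ k ≤
          (Finset.univ.filter fun w : W => eval (u + (w : Fin m → F)) f = 0).card →
        ∃ v ∈ W, dirDeriv f v u ≠ 0) := by
  let b := Module.finBasisOfFinrankEq F W hk
  let p : MvPolynomial (Fin (k + 1)) F :=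
    MvPolynomial.aeval (fun i => C (u i) + ∑ j, C ((b j : Fin m → F) i) * X j) f
  have hev : ∀ x : Fin (k + 1) → F,
      eval x p = eval (u + ((b.equivFun.symm x : W) : Fin m → F)) f := by
    intro x
    simp only [p]
    rw [← aeval_eq_eval, ← aeval_eq_eval, ← AlgHom.comp_apply, comp_aeval]
    congr 2
    funext i
    simp [Module.Basis.equivFun_symm_apply, Finset.sum_apply, mul_comm]
  have hdeg : p.totalDegree ≤ s + 1 := by
    refine totalDegree_aeval_le hf.totalDegree_le fun i => ?_
    refine (totalDegree_add _ _).trans (max_le (by simp) (totalDegree_finsetSum_le fun j _ => ?_))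
    exact (isHomogeneous_C_mul_X _ _).totalDegree_le
  have hp0 : p ≠ 0 := by
    obtain ⟨w, hw, hne⟩ := hu
    intro h0
    have := hev (b.equivFun ⟨w, hw⟩)
    rw [h0, LinearEquiv.symm_apply_apply, map_zero] at this
    exact hne this.symm
  have hcomp : ∀ x : Fin (k + 1) → F, ∀ i ≤ s + 1,
      eval x (homogeneousComponent i p) =
        lineCoeff f u ((b.equivFun.symm x : W) : Fin m → F) i := by
    intro x
    refine coeff_eq_of_sum_eq hq fun t => ?_
    rw [← hf.eval_line]
    have h1 := hev (t • x)
    rw [map_smul, Submodule.coe_smul] at h1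
    rw [← h1]
    conv_rhs => rw [← sum_homogeneousComponent p]
    rw [map_sum]
    simp only [(homogeneousComponent_isHomogeneous _ p).eval_smul']
    rw [Finset.sum_subset (Finset.range_mono (Nat.succ_le_succ hdeg)) fun i _ hi => by
      rw [homogeneousComponent_eq_zero _ _ (by simpa [Nat.lt_succ_iff] using hi), map_zero,
        mul_zero]]
    exact Finset.sum_congr rfl fun i _ => mul_comm _ _
  have hdeg' : p.totalDegree ≤ s := by
    refine totalDegree_le_of_homogeneousComponent_eq_zero hdeg ?_
    refine (homogeneousComponent_isHomogeneous _ p).eq_zero_of_forall_eval_eq_zero_of_le_card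
      (fun x => ?_) (by rw [Cardinal.mk_fintype]; exact_mod_cast hq.le)
    rw [hcomp x _ le_rfl, hf.lineCoeff_self hq, hW _ (Submodule.coe_mem _)]
  have hcard : (Finset.univ.filter fun w : W => eval (u + (w : Fin m → F)) f = 0).card =
      (Finset.univ.filter fun x : Fin (k + 1) → F => eval x p = 0).card := by
    refine Finset.card_equiv b.equivFun.toEquiv fun w => ?_
    simp only [Finset.mem_filter, Finset.mem_univ, true_and, hev, LinearEquiv.coe_toEquiv,
      LinearEquiv.symm_apply_apply]
  rw [hcard]
  refine ⟨card_zeros_le hp0 hdeg', fun h => ?_⟩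
  by_contra! hv
  obtain ⟨r, rfl⟩ := Nat.exists_eq_add_of_lt hs
  rw [zero_add] at *
  have hdeg'' : p.totalDegree ≤ r := by
    refine totalDegree_le_of_homogeneousComponent_eq_zero hdeg' ?_
    refine (homogeneousComponent_isHomogeneous _ p).eq_zero_of_forall_eval_eq_zero_of_le_card
      (fun x => ?_) (by rw [Cardinal.mk_fintype]; exact_mod_cast (by omega))
    rw [hcomp x _ (by omega), hf.lineCoeff_pred hq, hv _ (Submodule.coe_mem _)]
  have h1 := h.trans (card_zeros_le hp0 hdeg'')
  have h2 : 0 < Fintype.card F ^ k := pow_pos Fintype.card_pos k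
  nlinarith

open Polynomial in
theorem MvPolynomial.IsHomogeneous.card_zeros_line_le (hf : f.IsHomogeneous (s + 1))
    (hq : s + 1 < Fintype.card F) {u v : Fin m → F} (hv : MvPolynomial.eval v f = 0)
    (huv : dirDeriv f v u ≠ 0) :
    (Finset.univ.filter fun t : F => MvPolynomial.eval (u + t • v) f = 0).card ≤ s := by
  set p : F[X] := ∑ i ∈ Finset.range (s + 1),
    Polynomial.C (lineCoeff f u v i) * Polynomial.X ^ i with hp
  have hdeg : p.natDegree ≤ s := natDegree_sum_le_of_forall_le _ _ fun j hj =>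
    (natDegree_C_mul_X_pow_le _ _).trans (by simpa [Nat.lt_succ_iff] using hj)
  have hp0 : p ≠ 0 := fun h0 => huv <| by
    have := congrArg (fun r => r.coeff s) h0
    simpa [hp, finsetSum_coeff, coeff_X_pow, hf.lineCoeff_pred hq] using this
  refine (card_le_degree_of_subset_roots (Z := _) fun t ht => ?_).trans hdeg
  rw [Finset.mem_val, Finset.mem_filter, hf.eval_line, Finset.sum_range_succ,
    hf.lineCoeff_self hq, hv, zero_mul, add_zero] at ht
  rw [mem_roots hp0, IsRoot, hp, eval_finsetSum, ← ht.2]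
  simp

theorem sum_card_zeros_coset (f : MvPolynomial (Fin m) F) (W : Submodule F (Fin m → F))
    [DecidablePred (· ∈ W)] :
    ∑ u : Fin m → F, (Finset.univ.filter fun w : W => eval (u + (w : Fin m → F)) f = 0).card =
      Fintype.card W * (Finset.univ.filter fun u : Fin m → F => eval u f = 0).card := by
  simp only [Finset.card_filter]
  rw [Finset.sum_comm, ← Finset.card_univ, ← smul_eq_mul, ← Finset.sum_const]
  exact Finset.sum_congr rfl fun w _ =>
    Equiv.sum_comp (Equiv.addRight (w : Fin m → F)) fun u => if eval u f = 0 then 1 else 0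

theorem NP_mul (q N : ℕ) (hq : 0 < q) : NP q N * (q - 1) + 1 = q ^ (N + 1) := by
  obtain ⟨r, rfl⟩ := Nat.exists_eq_add_of_lt hq
  have := geom_sum_mul_add (r : ℕ) (N + 1)
  simpa [NP, add_comm] using this

/-- A hypersurface with the maximal number of points for its linear space `W` of maximal dimension
meets all affine translates of `W` extremally. -/
theorem isExtremalSubspace_of_card_zeros {N : ℕ} {f : MvPolynomial (Fin (N + 1)) F}
    {W : Submodule F (Fin (N + 1) → F)} (hq : Fintype.card F = s ^ 2)
    (hf : f.IsHomogeneous (s + 1)) (hW : ∀ w ∈ W, eval w f = 0)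
    (hk : Module.finrank F W = k + 1) (hmax : ∀ u ∉ W, ∃ w ∈ W, eval (u + w) f ≠ 0)
    (hZ : (Finset.univ.filter fun u : Fin (N + 1) → F => eval u f = 0).card +
      s * Fintype.card F ^ k = Fintype.card F ^ (k + 1) + s * Fintype.card F ^ N) :
    IsExtremalSubspace s f W := by
  have : DecidablePred (· ∈ W) := Classical.decPred _
  have hs := two_le_of_card_eq_sq hq
  have hq' := succ_lt_card_of_card_eq_sq hq
  have hWc : Fintype.card W = Fintype.card F ^ (k + 1) := by
    rw [Module.card_eq_pow_finrank (K := F), hk]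
  set q := Fintype.card F with hqdef
  set Nz : (Fin (N + 1) → F) → ℕ := fun u =>
    (Finset.univ.filter fun w : W => eval (u + (w : Fin (N + 1) → F)) f = 0).card with hNz
  have hle : ∀ u, Nz u ≤ if u ∈ W then q ^ (k + 1) else s * q ^ k := by
    intro u
    split_ifs with hu
    · exact (Finset.card_le_univ _).trans hWc.le
    · exact (hf.card_zeros_coset_le (by omega) hq' hW hk (hmax u hu)).1
  have hsum : ∑ u, Nz u = ∑ u : Fin (N + 1) → F, if u ∈ W then q ^ (k + 1) else s * q ^ k := by
    have h1 : ∑ u, Nz u = _ := sum_card_zeros_coset f W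
    have h2 : ∀ a : ℕ, (∑ u : Fin (N + 1) → F, if u ∈ W then a else 0) = q ^ (k + 1) * a := by
      intro a
      rw [← Finset.sum_filter, Finset.sum_const, smul_eq_mul, ← hWc, Fintype.card_subtype]
    have h3 : (∑ u : Fin (N + 1) → F, if u ∈ W then q ^ (k + 1) else s * q ^ k) +
        q ^ (k + 1) * (s * q ^ k) = q ^ (k + 1) * q ^ (k + 1) + q ^ (N + 1) * (s * q ^ k) := by
      have h4 : ∑ _u : Fin (N + 1) → F, s * q ^ k = q ^ (N + 1) * (s * q ^ k) := by
        rw [Finset.sum_const, smul_eq_mul, Finset.card_univ, Fintype.card_fun, Fintype.card_fin]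
      rw [← h2, ← h2, ← h4, ← Finset.sum_add_distrib, ← Finset.sum_add_distrib]
      refine Finset.sum_congr rfl fun u _ => ?_
      split_ifs <;> omega
    rw [hWc] at h1
    have h5 := congrArg (q ^ (k + 1) * ·) hZ
    simp only [mul_add] at h5
    have h6 : q ^ (k + 1) * (s * q ^ N) = q ^ (N + 1) * (s * q ^ k) := by ring
    omega
  have heq : ∀ u ∉ W, Nz u = s * q ^ k := fun u hu => by
    have := (Finset.sum_eq_sum_iff_of_le fun u _ => hle u).1 hsum u (Finset.mem_univ u)
    rwa [if_neg hu] at this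
  refine ⟨hq, hf, hW, fun u hu => (hf.card_zeros_coset_le (by omega) hq' hW hk (hmax u hu)).2
    (heq u hu).ge, fun u hu v hv huv => ?_⟩
  have hline : ∀ w : W, (Finset.univ.filter fun t : F =>
      eval (u + (w : Fin (N + 1) → F) + t • v) f = 0).card ≤ s := fun w =>
    hf.card_zeros_line_le hq' (hW v hv) (by
      rwa [dirDeriv_add, hf.dirDeriv_eq_zero_of_mem hq' hW hv w.2, add_zero])
  have hlsum : ∑ w : W, (Finset.univ.filter fun t : F =>
      eval (u + (w : Fin (N + 1) → F) + t • v) f = 0).card = ∑ _w : W, s := by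
    rw [Finset.sum_const, Finset.card_univ, smul_eq_mul, hWc, pow_succ, mul_right_comm,
      mul_comm (q ^ k), ← heq u hu, mul_comm, hqdef, ← Finset.card_univ, ← smul_eq_mul,
      ← Finset.sum_const]
    simp only [hNz, Finset.card_filter]
    rw [Finset.sum_comm]
    refine Finset.sum_congr rfl fun t _ => ?_
    symm
    rw [← Equiv.sum_comp (Equiv.addRight (t • ⟨v, hv⟩ : W))]
    exact Finset.sum_congr rfl fun w _ => if_congr (by simp [add_assoc]) rfl rfl
  have := (Finset.sum_eq_sum_iff_of_le fun w _ => hline w).1 hlsum 0 (Finset.mem_univ _)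
  simpa using this.ge

end Counting

namespace IsExtremalSubspace

variable {F : Type*} [Field F] [Fintype F] [DecidableEq F] {m s : ℕ}
  {f : MvPolynomial (Fin m) F} {W : Submodule F (Fin m → F)}

theorem dirDeriv_smul_left (h : IsExtremalSubspace s f W) (a : F) (w u : Fin m → F) :
    dirDeriv f (a • w) u = a ^ s * dirDeriv f w u :=
  h.isHomogeneous.dirDeriv_smul_left (succ_lt_card_of_card_eq_sq h.card_eq) w u a

theorem dirDeriv_zero_left (h : IsExtremalSubspace s f W) (u : Fin m → F) :
    dirDeriv f 0 u = 0 := by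
  have := h.dirDeriv_smul_left 0 0 u
  rwa [zero_smul, zero_pow (by have := two_le_of_card_eq_sq h.card_eq; omega), zero_mul] at this

theorem dirDeriv_sum_smul_left (h : IsExtremalSubspace s f W) {ι : Type*} (S : Finset ι)
    (d : ι → F) (b : ι → W) (u : Fin m → F) :
    dirDeriv f (∑ j ∈ S, d j • (b j : Fin m → F)) u =
      ∑ j ∈ S, d j ^ s * dirDeriv f (b j) u := by
  classical
  induction S using Finset.induction_on with
  | empty => simpa using h.dirDeriv_zero_left u
  | insert i S hi ih =>
    rw [Finset.sum_insert hi, Finset.sum_insert hi, h.dirDeriv_add_left u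
      (W.smul_mem _ (b i).2) (W.sum_mem fun j _ => W.smul_mem _ (b j).2), ih,
      h.dirDeriv_smul_left]

theorem mem_of_forall_dirDeriv_eq_zero (h : IsExtremalSubspace s f W) {u : Fin m → F}
    (hu : ∀ w ∈ W, dirDeriv f w u = 0) : u ∈ W := by
  by_contra hW
  obtain ⟨v, hv, hvu⟩ := h.exists_dirDeriv_ne_zero u hW
  exact hvu (hu v hv)

theorem two_mul_finrank (h : IsExtremalSubspace s f W)
    (hns : ∀ w ∈ W, w ≠ 0 → ∃ u, dirDeriv f w u ≠ 0) : 2 * Module.finrank F W = m := by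
  have hs := two_le_of_card_eq_sq h.card_eq
  let b := Module.finBasis F W
  let β : (Fin m → F) →ₗ[F] (Fin (Module.finrank F W) → F) :=
    { toFun := fun u j => dirDeriv f (b j) u
      map_add' := fun u u' => by funext j; exact dirDeriv_add _ _ _ _
      map_smul' := fun a u => by funext j; exact dirDeriv_smul _ _ _ _ }
  have hker : LinearMap.ker β = W := by
    ext u
    rw [LinearMap.mem_ker]
    refine ⟨fun hu => h.mem_of_forall_dirDeriv_eq_zero fun w hw => ?_, fun hu => ?_⟩
    · have hw' : w = ∑ j, b.repr ⟨w, hw⟩ j • (b j : Fin m → F) := by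
        have := congrArg Subtype.val (b.sum_repr ⟨w, hw⟩)
        simpa only [AddSubmonoidClass.coe_finsetSum, Submodule.coe_smul] using this.symm
      rw [hw', h.dirDeriv_sum_smul_left]
      refine Finset.sum_eq_zero fun j _ => ?_
      rw [show dirDeriv f (b j) u = 0 from congrFun hu j, mul_zero]
    · funext j
      exact h.dirDeriv_eq_zero (b j).2 hu
  have hrange : LinearMap.range β = ⊤ := by
    by_contra hne
    obtain ⟨φ, hφ, hle⟩ := Submodule.exists_le_ker_of_lt_top _ (lt_top_iff_ne_top.2 hne)
    let d : Fin (Module.finrank F W) → F := fun j => φ (Pi.single j 1) ^ s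
    have hd : (∑ j, d j • b j : W) ≠ 0 := by
      intro h0
      have h1 := Fintype.linearIndependent_iff.1 b.linearIndependent d h0
      refine hφ (LinearMap.pi_ext' fun j => LinearMap.ext_ring ?_)
      simpa using pow_eq_zero_iff (by omega) |>.1 (h1 j)
    obtain ⟨u, hu⟩ := hns (∑ j, d j • b j : W) (Submodule.coe_mem _)
      (by rwa [Ne, Submodule.coe_eq_zero])
    refine hu ?_
    have h2 : φ (β u) = 0 := hle (LinearMap.mem_range_self β u)
    rw [LinearMap.pi_apply_eq_sum_univ] at h2
    rw [← h2]
    have h3 : ((∑ j, d j • b j : W) : Fin m → F) = ∑ j, d j • (b j : Fin m → F) := by simp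
    rw [h3, h.dirDeriv_sum_smul_left]
    refine Finset.sum_congr rfl fun j _ => ?_
    rw [pow_pow_of_card_eq_sq h.card_eq, smul_eq_mul, mul_comm]
    congr 2
    funext i
    simp [Pi.single_apply, eq_comm]
  have := LinearMap.finrank_range_add_finrank_ker β
  rw [hker, hrange, finrank_top, Module.finrank_fin_fun, Module.finrank_fin_fun] at this
  omega

end IsExtremalSubspace

open Polynomial in
theorem eq_zero_of_sum_mul_pow_eq {F : Type*} [Field F] [Fintype F] {N M e : ℕ} {c c' : ℕ → F}
    (hN : N + e < Fintype.card F) (hM : M < Fintype.card F)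
    (h : ∀ t : F, (∑ i ∈ Finset.range (N + 1), c i * t ^ i) * t ^ e =
      ∑ i ∈ Finset.range (M + 1), c' i * t ^ i) {i : ℕ} (hi : i ≤ N) (hie : M < i + e) :
    c i = 0 := by
  have h1 := coeff_eq_of_sum_eq (D := max (N + e) M) (max_lt hN hM)
    (c := fun j => if j ∈ Finset.Icc e (N + e) then c (j - e) else 0)
    (c' := fun j => if j ∈ Finset.range (M + 1) then c' j else 0) (fun t => ?_) (i + e)
    (le_max_of_le_left (by omega))
  · simpa [show i ≤ N from hi, show ¬ i + e < M + 1 by omega] using h1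
  · have hs1 : Finset.Icc e (N + e) ⊆ Finset.range (max (N + e) M + 1) := fun j hj => by
      simp only [Finset.mem_Icc, Finset.mem_range] at hj ⊢; omega
    have hs2 : Finset.range (M + 1) ⊆ Finset.range (max (N + e) M + 1) := fun j hj => by
      simp only [Finset.mem_range] at hj ⊢; omega
    simp only [ite_mul, zero_mul, ← Finset.sum_filter, Finset.filter_mem_eq_inter,
      Finset.inter_eq_right.2 hs1, Finset.inter_eq_right.2 hs2]
    rw [← h, Finset.sum_mul]
    symm
    refine Finset.sum_bij (fun i _ => i + e) (fun i hi => ?_) (fun i _ j _ hij => by omega)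
      (fun j hj => ?_) fun i _ => ?_
    · simp only [Finset.mem_Icc, Finset.mem_range] at hi ⊢; omega
    · simp only [Finset.mem_Icc] at hj
      exact ⟨j - e, Finset.mem_range.2 (by omega), by omega⟩
    · rw [Nat.add_sub_cancel, pow_add, mul_assoc]

namespace IsExtremalSubspace

variable {F : Type*} [Field F] [Fintype F] [DecidableEq F] {m s : ℕ}
  {f : MvPolynomial (Fin m) F} {W : Submodule F (Fin m → F)}

theorem exists_smul_dirDeriv_eq_one (h : IsExtremalSubspace s f W) {u x : Fin m → F}
    (hx : dirDeriv f x u ≠ 0) : ∃ a : F, dirDeriv f (a • x) u = 1 := by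
  refine ⟨(dirDeriv f x u)⁻¹ ^ s, ?_⟩
  rw [h.dirDeriv_smul_left, pow_pow_of_card_eq_sq h.card_eq, inv_mul_cancel₀ hx]

theorem exists_dirDeriv_eq_zero_one (h : IsExtremalSubspace s f W) {u u' : Fin m → F}
    (hu : ∀ a b : F, a • u + b • u' ∈ W → a = 0 ∧ b = 0) :
    ∃ x ∈ W, dirDeriv f x u = 0 ∧ dirDeriv f x u' = 1 := by
  have hs := two_le_of_card_eq_sq h.card_eq
  have huW : u ∉ W := fun hW => one_ne_zero (hu 1 0 (by simpa using hW)).1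
  obtain ⟨v, hv, hvu⟩ := h.exists_dirDeriv_eq_one huW
  have key : ∃ x ∈ W, dirDeriv f x u = 0 ∧ dirDeriv f x u' ≠ 0 := by
    by_contra! hcon
    have : (-dirDeriv f v u') • u + (1 : F) • u' ∈ W := by
      refine h.mem_of_forall_dirDeriv_eq_zero fun w hw => ?_
      set d := (-dirDeriv f w u) ^ s with hd
      have hds : d ^ s = -dirDeriv f w u := pow_pow_of_card_eq_sq h.card_eq _
      have h1 := hcon (w + d • v) (W.add_mem hw (W.smul_mem d hv))
      rw [h.dirDeriv_add_left _ hw (W.smul_mem d hv), h.dirDeriv_add_left _ hw (W.smul_mem d hv),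
        h.dirDeriv_smul_left, h.dirDeriv_smul_left, hds, hvu] at h1
      rw [dirDeriv_add, dirDeriv_smul, dirDeriv_smul]
      linear_combination h1 (by ring)
    exact one_ne_zero (hu _ _ this).2
  obtain ⟨x, hx, hxu, hxu'⟩ := key
  obtain ⟨a, ha⟩ := h.exists_smul_dirDeriv_eq_one hxu'
  exact ⟨a • x, W.smul_mem a hx, by rw [h.dirDeriv_smul_left, hxu, mul_zero], ha⟩

theorem lineCoeff_eq_zero_and_dirDeriv_eq (h : IsExtremalSubspace s f W) {u u' : Fin m → F}
    (hu : ∀ a b : F, a • u + b • u' ∈ W → a = 0 ∧ b = 0) :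
    (∀ w ∈ W, ∀ i, 2 ≤ i → i < s → lineCoeff f u w i = 0) ∧
      ∃ a : F, (∀ w ∈ W, dirDeriv f u w = a * dirDeriv f w u ^ s) ∧
        ∀ w ∈ W, dirDeriv f (u + u') w = a * dirDeriv f w (u + u') ^ s := by
  have hs := two_le_of_card_eq_sq h.card_eq
  have hq := succ_lt_card_of_card_eq_sq h.card_eq
  have hu' : ∀ a b : F, a • u' + b • u ∈ W → a = 0 ∧ b = 0 := fun a b hab =>
    (hu b a (by rwa [add_comm])).symm
  obtain ⟨x₁, hx₁, h₁u', h₁u⟩ := h.exists_dirDeriv_eq_zero_one hu'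
  obtain ⟨x₂, hx₂, h₂u, h₂u'⟩ := h.exists_dirDeriv_eq_zero_one hu
  obtain ⟨c₁, hc₁0, hc₁⟩ := h.isHomogeneous.exists_coeff_three u u' x₁
  obtain ⟨c₂, hc₂0, hc₂⟩ := h.isHomogeneous.exists_coeff_three u u' x₂
  have hmem : ∀ a b : F, (a ≠ 0 ∨ b ≠ 0) → a • u + b • u' ∉ W := fun a b hab hW => by
    have := hu a b hW
    tauto
  choose! p hp using fun z (hz : z ∉ W) => h.exists_lineCoeff_eq hz
  have e₁ : ∀ a b : F, (a ≠ 0 ∨ b ≠ 0) → ∀ j ≤ s + 1,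
      ∑ i ∈ Finset.range (s + 1 + 1), c₁ i j * a ^ (s + 1 - i - j) * b ^ i =
        p (a • u + b • u') j * a ^ (s * j) := by
    intro a b hab j hj
    have := coeff_eq_of_sum_eq hq (c := lineCoeff f (a • u + b • u') x₁) (c' := fun j =>
      ∑ i ∈ Finset.range (s + 1 + 1), c₁ i j * a ^ (s + 1 - i - j) * b ^ i)
      (fun t => by rw [← h.isHomogeneous.eval_line, hc₁]) j hj
    rw [← this, hp _ (hmem a b hab) _ hx₁ _ hj,
      dirDeriv_add, dirDeriv_smul, dirDeriv_smul, h₁u, h₁u', mul_one, mul_zero, add_zero]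
  have e₂ : ∀ a b : F, (a ≠ 0 ∨ b ≠ 0) → ∀ j ≤ s + 1,
      ∑ i ∈ Finset.range (s + 1 + 1), c₂ i j * a ^ (s + 1 - i - j) * b ^ i =
        p (a • u + b • u') j * b ^ (s * j) := by
    intro a b hab j hj
    have := coeff_eq_of_sum_eq hq (c := lineCoeff f (a • u + b • u') x₂) (c' := fun j =>
      ∑ i ∈ Finset.range (s + 1 + 1), c₂ i j * a ^ (s + 1 - i - j) * b ^ i)
      (fun t => by rw [← h.isHomogeneous.eval_line, hc₂]) j hj
    rw [← this, hp _ (hmem a b hab) _ hx₂ _ hj,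
      dirDeriv_add, dirDeriv_smul, dirDeriv_smul, h₂u, h₂u', mul_one, mul_zero, zero_add]
  have htop : ∀ j, 1 ≤ j → j < s → c₁ (s + 1 - j) j = 0 := by
    intro j hj hjs
    have := e₁ 0 1 (Or.inr one_ne_zero) j (by omega)
    rw [zero_pow (Nat.mul_ne_zero (by omega) (by omega)), mul_zero,
      Finset.sum_eq_single_of_mem (s + 1 - j) (Finset.mem_range.2 (by omega))] at this
    · simpa [show s + 1 - (s + 1 - j) - j = 0 by omega] using this
    · intro i _ hi
      rcases lt_or_gt_of_ne hi with hi | hi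
      · rw [zero_pow (by omega)]; simp
      · rw [hc₁0 i j (by omega)]; simp
  have hsum : ∀ j, 1 ≤ j → j < s → ∀ t : F,
      ∑ i ∈ Finset.range (s - j + 1), c₁ i j * t ^ i = p (u + t • u') j := by
    intro j hj hjs t
    have := e₁ 1 t (Or.inl one_ne_zero) j (by omega)
    rw [one_smul, one_pow, mul_one] at this
    rw [← this]
    simp only [one_pow, mul_one]
    refine Finset.sum_subset (Finset.range_mono (by omega)) fun i _ hi => ?_
    rw [Finset.mem_range, not_lt] at hi
    rcases hi.eq_or_lt with hi | hi
    · rw [← hi, show s - j + 1 = s + 1 - j by omega, htop j hj hjs, zero_mul]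
    · rw [hc₁0 i j (by omega), zero_mul]
  have hzero : ∀ j, 1 ≤ j → j < s → ∀ i ≤ s - j, 1 < i + j → c₁ i j = 0 := by
    intro j hj hjs i hi hij
    have hle : s * j ≤ s * (s - 1) := Nat.mul_le_mul_left s (by omega)
    have hcard : Fintype.card F = s * (s - 1) + s := by
      rw [h.card_eq, sq, ← Nat.mul_succ]; congr 1; omega
    have hle' : s ≤ s * j := Nat.le_mul_of_pos_right s hj
    refine eq_zero_of_sum_mul_pow_eq (N := s - j) (M := s + 1 - j) (e := s * j)
      (c := fun i => c₁ i j) (c' := fun i => c₂ i j) (by omega) (by omega) (fun t => ?_) hi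
      (by omega)
    have := e₂ 1 t (Or.inl one_ne_zero) j (by omega)
    rw [one_smul] at this
    rw [hsum j hj hjs, ← this]
    simp only [one_pow, mul_one]
    refine (Finset.sum_subset (Finset.range_mono (by omega)) fun i _ hi => ?_).symm
    rw [Finset.mem_range, not_lt] at hi
    rw [hc₂0 i j (by omega), zero_mul]
  have hone : ∀ t : F, p (u + t • u') 1 = c₁ 0 1 := by
    intro t
    rw [← hsum 1 le_rfl (by omega), Finset.sum_range_succ', Finset.sum_eq_zero fun i hi => ?_]
    · simp
    · rw [hzero 1 le_rfl (by omega) (i + 1) (by have := Finset.mem_range.1 hi; omega) (by omega),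
        zero_mul]
  have huW : u ∉ W := by simpa using hmem 1 0 (Or.inl one_ne_zero)
  refine ⟨fun w hw i hi his => ?_, c₁ 0 1, fun w hw => ?_, fun w hw => ?_⟩
  · rw [hp u huW w hw i (by omega)]
    have := hsum i (by omega) his 0
    rw [zero_smul, add_zero] at this
    rw [← this, Finset.sum_eq_zero fun j hj => ?_, zero_mul]
    rw [hzero i (by omega) his j (by have := Finset.mem_range.1 hj; omega) (by omega), zero_mul]
  · rw [← lineCoeff_one, hp u huW w hw 1 (by omega), mul_one, ← hone 0, zero_smul, add_zero]
  · rw [← lineCoeff_one, hp _ (by simpa using hmem 1 1 (Or.inl one_ne_zero)) w hw 1 (by omega),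
      mul_one, ← hone 1, one_smul]

end IsExtremalSubspace

theorem Submodule.exists_independent_mod {F : Type*} [Field F] {m : ℕ}
    {W : Submodule F (Fin m → F)} (hdim : Module.finrank F W + 2 ≤ m)
    {u : Fin m → F} (hu : u ∉ W) :
    ∃ z : Fin m → F, ∀ a b : F, a • u + b • z ∈ W → a = 0 ∧ b = 0 := by
  have hne : W ⊔ F ∙ u ≠ ⊤ := fun htop => by
    have h1 := Submodule.finrank_add_le_finrank_add_finrank W (F ∙ u)
    have h2 := finrank_span_singleton (K := F) (v := u) fun h0 => hu (h0 ▸ W.zero_mem)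
    rw [htop, finrank_top, Module.finrank_fin_fun] at h1
    omega
  obtain ⟨z, -, hz⟩ := SetLike.exists_of_lt (lt_top_iff_ne_top.2 hne)
  refine ⟨z, fun a b hab => ?_⟩
  have hb : b = 0 := by
    by_contra hb
    refine hz (Submodule.mem_sup.2 ⟨b⁻¹ • (a • u + b • z), W.smul_mem _ hab, (-(b⁻¹ * a)) • u,
      Submodule.mem_span_singleton.2 ⟨_, rfl⟩, ?_⟩)
    rw [smul_add, smul_smul, smul_smul, inv_mul_cancel₀ hb]
    module
  refine ⟨?_, hb⟩
  by_contra ha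
  rw [hb, zero_smul, add_zero] at hab
  exact hu ((W.smul_mem_iff ha).1 hab)

namespace IsExtremalSubspace

variable {F : Type*} [Field F] [Fintype F] [DecidableEq F] {m s : ℕ}
  {f : MvPolynomial (Fin m) F} {W : Submodule F (Fin m → F)}

theorem exists_eval_add_eq (h : IsExtremalSubspace s f W) (hdim : Module.finrank F W + 2 ≤ m) :
    ∃ a : F, ∀ u ∉ W, ∀ w ∈ W,
      eval (u + w) f = eval u f + a * dirDeriv f w u ^ s + dirDeriv f w u := by
  have hs := two_le_of_card_eq_sq h.card_eq
  have hq := succ_lt_card_of_card_eq_sq h.card_eq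
  have h1 : ∀ u ∉ W, ∃ a : F, ∀ w ∈ W, dirDeriv f u w = a * dirDeriv f w u ^ s := by
    intro u hu
    obtain ⟨z, hz⟩ := Submodule.exists_independent_mod hdim hu
    obtain ⟨-, a, ha, -⟩ := h.lineCoeff_eq_zero_and_dirDeriv_eq hz
    exact ⟨a, ha⟩
  choose! α hα using h1
  have huniq : ∀ u ∉ W, ∀ a b : F, (∀ w ∈ W, dirDeriv f u w = a * dirDeriv f w u ^ s) →
      (∀ w ∈ W, dirDeriv f u w = b * dirDeriv f w u ^ s) → a = b := by
    intro u hu a b ha hb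
    obtain ⟨v, hv, hvu⟩ := h.exists_dirDeriv_eq_one hu
    have := (ha v hv).symm.trans (hb v hv)
    simpa [hvu] using this
  have hind : ∀ u u' : Fin m → F, (∀ a b : F, a • u + b • u' ∈ W → a = 0 ∧ b = 0) →
      α u = α u' := by
    intro u u' hu
    have hu' : ∀ a b : F, a • u' + b • u ∈ W → a = 0 ∧ b = 0 := fun a b hab =>
      (hu b a (by rwa [add_comm])).symm
    have huW : u ∉ W := fun hW => one_ne_zero (hu 1 0 (by simpa using hW)).1
    have huW' : u' ∉ W := fun hW => one_ne_zero (hu 0 1 (by simpa using hW)).2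
    have hsW : u + u' ∉ W := fun hW => one_ne_zero (hu 1 1 (by simpa using hW)).1
    obtain ⟨-, a, ha, ha'⟩ := h.lineCoeff_eq_zero_and_dirDeriv_eq hu
    obtain ⟨-, b, hb, hb'⟩ := h.lineCoeff_eq_zero_and_dirDeriv_eq hu'
    rw [add_comm] at hb'
    rw [huniq u huW _ _ (hα u huW) ha, huniq u' huW' _ _ (hα u' huW') hb,
      huniq _ hsW _ _ ha' hb']
  have hconst : ∀ u u' : Fin m → F, u ∉ W → u' ∉ W → α u = α u' := by
    intro u u' hu hu'
    by_cases hcase : ∀ a b : F, a • u + b • u' ∈ W → a = 0 ∧ b = 0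
    · exact hind u u' hcase
    push Not at hcase
    obtain ⟨a, b, hab, hne⟩ := hcase
    have ha : a ≠ 0 := by
      intro ha
      rw [ha, zero_smul, zero_add] at hab
      exact hu' ((W.smul_mem_iff (hne ha)).1 hab)
    obtain ⟨z, hz⟩ := Submodule.exists_independent_mod hdim hu'
    rw [hind u' z hz, hind u z fun c d hcd => ?_]
    have h2 : (-(c * a⁻¹ * b)) • u' + d • z ∈ W := by
      have : (-(c * a⁻¹ * b)) • u' + d • z =
          (c • u + d • z) - (c * a⁻¹) • (a • u + b • u') := by
        rw [smul_add, smul_smul, smul_smul, mul_assoc c a⁻¹ a, inv_mul_cancel₀ ha, mul_one]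
        module
      rw [this]
      exact W.sub_mem hcd (W.smul_mem _ hab)
    obtain ⟨-, hd⟩ := hz _ _ h2
    refine ⟨?_, hd⟩
    rw [hd, zero_smul, add_zero] at hcd
    by_contra hc
    exact hu ((W.smul_mem_iff hc).1 hcd)
  by_cases hW : ∃ u₀, u₀ ∉ W
  · obtain ⟨u₀, hu₀⟩ := hW
    refine ⟨α u₀, fun u hu w hw => ?_⟩
    obtain ⟨z, hz⟩ := Submodule.exists_independent_mod hdim hu
    obtain ⟨hmid, -⟩ := h.lineCoeff_eq_zero_and_dirDeriv_eq hz
    obtain ⟨r, rfl⟩ : ∃ r, s = r + 2 := ⟨s - 2, by omega⟩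
    have := h.isHomogeneous.eval_line u w 1
    simp only [one_smul, one_pow, mul_one] at this
    rw [this, Finset.sum_range_succ, Finset.sum_range_succ, Finset.sum_range_succ',
      Finset.sum_range_succ', h.isHomogeneous.lineCoeff_self hq,
      h.isHomogeneous.lineCoeff_pred hq, h.eval_eq_zero w hw, lineCoeff_zero, zero_add,
      lineCoeff_one, hα u hu w hw, hconst u u₀ hu hu₀, Finset.sum_eq_zero fun i hi => ?_]
    · ring
    · exact hmid w hw _ (by omega) (by have := Finset.mem_range.1 hi; omega)
  · push Not at hW
    exact ⟨0, fun u hu => absurd (hW u) hu⟩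

/-- Up to a scalar, `f` takes values in the subfield with `s` elements. -/
theorem exists_mul_eval_pow_eq (h : IsExtremalSubspace s f W)
    (hdim : Module.finrank F W + 2 ≤ m) (hf : ∃ u, eval u f ≠ 0) :
    ∃ μ : F, μ ≠ 0 ∧ ∀ u, (μ * eval u f) ^ s = μ * eval u f := by
  have hs := two_le_of_card_eq_sq h.card_eq
  obtain ⟨a, ha⟩ := h.exists_eval_add_eq hdim
  have key : ∀ u ∉ W, a * a ^ s = 1 ∧ eval u f ^ s = a ^ s * eval u f := by
    intro u hu
    obtain ⟨v, hv, hvu⟩ := h.exists_dirDeriv_eq_one hu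
    have h1 : ∀ t : F, eval (u + t • v) f = eval u f + a * t + t ^ s := fun t => by
      rw [ha u hu _ (W.smul_mem t hv), h.dirDeriv_smul_left, hvu, mul_one,
        pow_pow_of_card_eq_sq h.card_eq]
    have h2 := hs.trans (h.le_card_roots u hu v hv (by rw [hvu]; exact one_ne_zero))
    obtain ⟨t₁, ht₁, t₂, ht₂, hne⟩ := Finset.one_lt_card.1 h2
    simp only [Finset.mem_filter, Finset.mem_univ, true_and, h1] at ht₁ ht₂
    set z := t₁ - t₂ with hz
    have hz0 : z ≠ 0 := sub_ne_zero.2 hne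
    have h3 : a * z = -z ^ s := by
      rw [hz, sub_pow_of_card_eq_sq h.card_eq]
      linear_combination ht₁ - ht₂
    have h4 : a ^ s * z ^ s = -z := by
      rw [← mul_pow, h3, neg_pow_of_card_eq_sq h.card_eq, pow_pow_of_card_eq_sq h.card_eq]
    have h5 : a * a ^ s = 1 := by
      have : z * z ^ s ≠ 0 := mul_ne_zero hz0 (pow_ne_zero _ hz0)
      refine mul_right_cancel₀ this ?_
      linear_combination a ^ s * z ^ s * h3 - z ^ s * h4
    refine ⟨h5, ?_⟩
    have h6 : eval u f = -(a * t₁ + t₁ ^ s) := by linear_combination ht₁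
    have h7 : eval u f ^ s = -(a ^ s * t₁ ^ s + t₁) := by
      rw [h6, neg_pow_of_card_eq_sq h.card_eq, add_pow_of_card_eq_sq h.card_eq, mul_pow,
        pow_pow_of_card_eq_sq h.card_eq]
    rw [h7, h6]
    linear_combination t₁ * h5
  obtain ⟨u₀, hu₀⟩ := hf
  have hu₀W : u₀ ∉ W := fun hW => hu₀ (h.eval_eq_zero u₀ hW)
  refine ⟨(eval u₀ f)⁻¹, inv_ne_zero hu₀, fun u => ?_⟩
  by_cases hu : u ∈ W
  · rw [h.eval_eq_zero u hu, mul_zero, zero_pow (by omega)]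
  · have ha0 : a ^ s ≠ 0 := right_ne_zero_of_mul_eq_one (key u hu).1
    rw [mul_pow, inv_pow, (key u hu).2, (key u₀ hu₀W).2, mul_inv]
    field_simp

end IsExtremalSubspace

section Hermitian

variable {F : Type*} [Field F] [Fintype F] {s : ℕ}

theorem exists_pow_succ_eq_of_card_eq_sq (hq : Fintype.card F = s ^ 2) {b : F} (hb : b ≠ 0)
    (hbs : b ^ s = b) : ∃ z, z ^ (s + 1) = b := by
  have hs := two_le_of_card_eq_sq hq
  obtain ⟨g, hg⟩ := IsCyclic.exists_monoid_generator (α := Fˣ)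
  obtain ⟨k, hk⟩ := hg (Units.mk0 b hb)
  obtain ⟨r, rfl⟩ : ∃ r, s = r + 1 := ⟨s - 1, by omega⟩
  have hord : orderOf g = r * (r + 1 + 1) := by
    rw [orderOf_eq_card_of_forall_mem_powers hg, Nat.card_units, Nat.card_eq_fintype_card, hq]
    exact Nat.sub_eq_of_eq_add (by ring)
  have h1 : g ^ (r * k) = 1 := by
    rw [mul_comm, pow_mul, show g ^ k = Units.mk0 b hb from hk]
    ext
    refine mul_right_cancel₀ hb ?_
    simpa [← pow_succ] using hbs
  have h2 := orderOf_dvd_of_pow_eq_one h1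
  rw [hord] at h2
  obtain ⟨l, hl⟩ := Nat.dvd_of_mul_dvd_mul_left (by omega) h2
  refine ⟨((g ^ l : Fˣ) : F), ?_⟩
  rw [← Units.val_pow_eq_pow_val, ← pow_mul, mul_comm, ← hl, show g ^ k = Units.mk0 b hb from hk,
    Units.val_mk0]

theorem eq_zero_of_forall_mul_add_pow_eq_zero (hq : Fintype.card F = s ^ 2) {b : F}
    (h : ∀ c : F, c * b + (c * b) ^ s = 0) : b = 0 := by
  have hs := two_le_of_card_eq_sq hq
  have hq' := succ_lt_card_of_card_eq_sq hq
  have := coeff_eq_of_sum_eq (D := s) (by omega)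
    (c := fun i => (if i = 1 then b else 0) + if i = s then b ^ s else 0) (c' := 0) (fun t => ?_) 1
    (by omega)
  · simpa [show ¬ 1 = s by omega] using this
  · have h1 := h t
    rw [mul_pow] at h1
    simp [add_mul, Finset.sum_add_distrib, show 1 < s + 1 by omega]
    linear_combination h1

/-- A nondegenerate Hermitian form over a finite field has an orthonormal basis. -/
theorem exists_orthonormal_of_card_eq_sq (hq : Fintype.card F = s ^ 2) {V : Type*}
    [AddCommGroup V] [Module F V] [FiniteDimensional F V] (B : V → V →ₗ[F] F)
    (hB : ∀ u v, B u v = B v u ^ s) (hnd : ∀ u, B u = 0 → u = 0) :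
    ∀ r ≤ Module.finrank F V, ∃ e : Fin r → V, ∀ i j, B (e i) (e j) = if i = j then 1 else 0 := by
  have hs := two_le_of_card_eq_sq hq
  intro r
  induction r with
  | zero => exact fun _ => ⟨Fin.elim0, fun i => i.elim0⟩
  | succ r ih =>
    intro hr
    obtain ⟨e, he⟩ := ih (by omega)
    have hx : ∃ x, (∀ i, B (e i) x = 0) ∧ B x x ≠ 0 := by
      by_contra! hcon
      have hker : LinearMap.ker (LinearMap.pi fun i => B (e i)) ≠ ⊥ :=
        LinearMap.ker_ne_bot_of_finrank_lt (by rw [Module.finrank_fin_fun]; omega)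
      obtain ⟨y, hy, hy0⟩ := Submodule.exists_mem_ne_zero_of_ne_bot hker
      have hy' : ∀ i, B (e i) y = 0 := fun i => congrFun (LinearMap.mem_ker.1 hy) i
      refine hy0 (hnd y (LinearMap.ext fun v => ?_))
      set z := v - ∑ i, B (e i) v • e i with hz
      have hz' : ∀ i, B (e i) z = 0 := by
        intro i
        simp [hz, map_sub, map_sum, he]
      have hyz : B y z = 0 := by
        refine eq_zero_of_forall_mul_add_pow_eq_zero hq fun c => ?_
        have h1 := hcon (y + c • z) fun i => by
          rw [map_add, map_smul, hy', hz', smul_zero, add_zero]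
        have h2 : B (y + c • z) y = (c * B y z) ^ s := by
          rw [hB, map_add, hcon y hy', map_smul, zero_add, smul_eq_mul]
        have h3 : B (y + c • z) z = B y z := by
          rw [hB, map_add, map_smul, hcon z hz', smul_zero, add_zero, ← hB]
        rw [map_add, map_smul, h2, h3, smul_eq_mul] at h1
        linear_combination h1
      have hv : v = z + ∑ i, B (e i) v • e i := by rw [hz, sub_add_cancel]
      rw [hv, map_add, hyz, map_sum, zero_add, LinearMap.zero_apply]
      refine Finset.sum_eq_zero fun i _ => ?_
      rw [map_smul, hB y, hy', zero_pow (by omega), smul_zero]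
    obtain ⟨x, hx, hxx⟩ := hx
    obtain ⟨z, hz⟩ := exists_pow_succ_eq_of_card_eq_sq hq (inv_ne_zero hxx)
      (by rw [inv_pow, ← hB])
    have hx' : ∀ i, B x (e i) = 0 := fun i => by rw [hB, hx, zero_pow (by omega)]
    have hzx : ∀ v, B (z • x) v = z ^ s * B x v := fun v => by
      rw [hB, map_smul, smul_eq_mul, mul_pow, ← hB]
    refine ⟨Fin.snoc e (z • x), fun i j => ?_⟩
    refine Fin.lastCases ?_ (fun i => ?_) i <;> refine Fin.lastCases ?_ (fun j => ?_) j
    · rw [Fin.snoc_last, hzx, map_smul, smul_eq_mul, if_pos rfl, ← mul_assoc, ← pow_succ, hz,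
        inv_mul_cancel₀ hxx]
    · rw [Fin.snoc_last, Fin.snoc_castSucc, hzx, hx', mul_zero,
        if_neg (Fin.castSucc_lt_last j).ne']
    · rw [Fin.snoc_last, Fin.snoc_castSucc, map_smul, hx, smul_zero,
        if_neg (Fin.castSucc_lt_last i).ne]
    · rw [Fin.snoc_castSucc, Fin.snoc_castSucc, he]
      simp only [Fin.castSucc_inj]

variable {m : ℕ} {f : MvPolynomial (Fin m) F}

open Polynomial in
theorem sum_C_mul_X_pow_eq_of_eval_eq {N : ℕ} {c c' : ℕ → F} {e e' : ℕ → ℕ}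
    (he : ∀ i < N, e i < Fintype.card F) (he' : ∀ i < N, e' i < Fintype.card F)
    (h : ∀ t : F, ∑ i ∈ Finset.range N, c i * t ^ e i = ∑ i ∈ Finset.range N, c' i * t ^ e' i) :
    ∑ i ∈ Finset.range N, C (c i) * X ^ e i = ∑ i ∈ Finset.range N, C (c' i) * X ^ e' i := by
  have hpos : 0 < Fintype.card F := Fintype.card_pos
  have hdeg : ∀ (c : ℕ → F) (e : ℕ → ℕ), (∀ i < N, e i < Fintype.card F) →
      (∑ i ∈ Finset.range N, C (c i) * X ^ e i).natDegree ≤ Fintype.card F - 1 := fun c e he =>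
    natDegree_sum_le_of_forall_le _ _ fun i hi => (natDegree_C_mul_X_pow_le _ _).trans
      (Nat.le_sub_one_of_lt (he i (Finset.mem_range.1 hi)))
  rw [← sub_eq_zero]
  refine eq_zero_of_natDegree_lt_card_of_eval_eq_zero _ Function.injective_id (fun t => ?_)
    ((natDegree_sub_le_of_le (hdeg c e he) (hdeg c' e' he')).trans_lt ?_)
  · simp [eval_finsetSum, h t]
  · rw [max_self]
    exact Nat.sub_lt hpos one_pos

theorem MvPolynomial.IsHomogeneous.dirDeriv_eq_pow (hq : Fintype.card F = s ^ 2)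
    (hf : f.IsHomogeneous (s + 1)) (hfs : ∀ u, eval u f ^ s = eval u f) (u v : Fin m → F) :
    dirDeriv f u v = dirDeriv f v u ^ s := by
  have hs := two_le_of_card_eq_sq hq
  have hq' := succ_lt_card_of_card_eq_sq hq
  obtain ⟨σ, hσ⟩ := exists_ringHom_pow_of_card_eq_sq hq
  set φ := lineCoeff f u v
  have hpoly := sum_C_mul_X_pow_eq_of_eval_eq (N := s + 1 + 1) (c := fun i => φ i ^ s)
    (e := fun i => if i = s then 1 else if i = s + 1 then s + 1 else s * i) (c' := φ)
    (e' := fun i => i) (fun i hi => ?_) (fun i hi => by omega) fun t => ?_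
  · have h1 := congrArg (fun r => r.coeff 1) hpoly
    simp only [Polynomial.finsetSum_coeff, Polynomial.coeff_C_mul, Polynomial.coeff_X_pow] at h1
    rw [Finset.sum_eq_single_of_mem s (by simp) fun i _ hi => ?_,
      Finset.sum_eq_single_of_mem 1 (by simp) fun i _ hi => by rw [if_neg hi.symm, mul_zero]] at h1
    · simp only [if_true, mul_one] at h1
      rw [← lineCoeff_one, ← hf.lineCoeff_pred hq' u v]
      exact h1.symm
    · rw [if_neg fun h => ?_, mul_zero]
      rw [if_neg hi] at h
      split_ifs at h
      · omega
      · have := Nat.eq_one_of_mul_eq_one_right h.symm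
        omega
  · split_ifs
    · omega
    · exact hq'
    · rw [hq, sq]
      exact Nat.mul_lt_mul_of_pos_left (by omega) (by omega)
  · rw [← hf.eval_line, ← hfs, hf.eval_line, ← hσ, map_sum]
    refine Finset.sum_congr rfl fun i _ => ?_
    have ht := pow_pow_of_card_eq_sq hq t
    rw [map_mul, map_pow, hσ, hσ]
    split_ifs with h1 h2
    · rw [h1, ht, pow_one]
    · rw [h2, pow_succ (t ^ s), ht, pow_succ']
    · rw [pow_mul]

theorem MvPolynomial.IsHomogeneous.dirDeriv_self (hq : Fintype.card F = s ^ 2)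
    (hf : f.IsHomogeneous (s + 1)) (u : Fin m → F) : dirDeriv f u u = eval u f := by
  have hs : (s : F) = 0 := by
    have := FiniteField.cast_card_eq_zero F
    rw [hq, Nat.cast_pow] at this
    exact pow_eq_zero_iff two_ne_zero |>.1 this
  have := congrArg (eval u) hf.sum_X_mul_pderiv
  simpa [dirDeriv, hs] using this

/-- A nonsingular form of degree `s + 1` with values in the field of `s` elements is Hermitian. -/
theorem MvPolynomial.IsHomogeneous.exists_eq_sum_X_pow (hq : Fintype.card F = s ^ 2)
    (hf : f.IsHomogeneous (s + 1)) (hfs : ∀ u, eval u f ^ s = eval u f)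
    (hns : ¬ ∃ v : Fin m → F, IsSingPt f v) :
    ∃ T : Matrix (Fin m) (Fin m) F, IsUnit T.det ∧
      MvPolynomial.aeval (fun i => ∑ j, MvPolynomial.C (T i j) * MvPolynomial.X j) f =
        ∑ i : Fin m, MvPolynomial.X i ^ (s + 1) := by
  have hs := two_le_of_card_eq_sq hq
  have hq' := succ_lt_card_of_card_eq_sq hq
  let B : (Fin m → F) → (Fin m → F) →ₗ[F] F := fun u =>
    { toFun := dirDeriv f u
      map_add' := dirDeriv_add f u
      map_smul' := fun a v => dirDeriv_smul f u v a }
  have hB : ∀ u v, B u v = B v u ^ s := hf.dirDeriv_eq_pow hq hfs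
  have hself : ∀ u, B u u = eval u f := hf.dirDeriv_self hq
  have hnd : ∀ u, B u = 0 → u = 0 := by
    intro u hu
    by_contra hu0
    refine hns ⟨u, hu0, by rw [← hself, hu, LinearMap.zero_apply], fun i => ?_⟩
    have : dirDeriv f u (Pi.single i 1) = 0 := LinearMap.congr_fun hu _
    simpa [dirDeriv, Pi.single_apply] using this
  obtain ⟨e, he⟩ := exists_orthonormal_of_card_eq_sq hq B hB hnd m (Module.finrank_fin_fun F).ge
  have hcoord : ∀ (x : Fin m → F) i, B (e i) (∑ j, x j • e j) = x i := fun x i => by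
    simp [map_sum, he]
  let T : Matrix (Fin m) (Fin m) F := Matrix.of fun i j => e j i
  have hT : ∀ x, T.mulVec x = ∑ j, x j • e j := fun x => by
    funext i
    simp [T, Matrix.mulVec, dotProduct, mul_comm]
  refine ⟨T, ?_, ?_⟩
  · rw [← Matrix.isUnit_iff_isUnit_det, ← Matrix.mulVec_injective_iff_isUnit]
    intro x y hxy
    funext i
    rw [← hcoord x, ← hcoord y, ← hT, ← hT, hxy]
  · have h1 : (MvPolynomial.aeval (fun i => ∑ j, MvPolynomial.C (T i j) * MvPolynomial.X j)
        f).IsHomogeneous (s + 1) := by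
      have := hf.aeval (n := 1) (fun i => ∑ j, MvPolynomial.C (T i j) * MvPolynomial.X j :
        Fin m → MvPolynomial (Fin m) F) fun i => IsHomogeneous.sum _ _ _ fun j _ =>
          isHomogeneous_C_mul_X _ _
      rwa [one_mul] at this
    refine h1.funext_of_le_card (IsHomogeneous.sum _ _ _ fun j _ => isHomogeneous_X_pow _ _)
      (fun x => ?_) (by rw [Cardinal.mk_fintype]; exact_mod_cast hq'.le)
    have h2 : eval x (MvPolynomial.aeval (fun i => ∑ j, MvPolynomial.C (T i j) *
        MvPolynomial.X j) f) = eval (T.mulVec x) f := by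
      rw [← aeval_eq_eval, ← aeval_eq_eval, ← AlgHom.comp_apply, comp_aeval]
      congr 2
      funext i
      simp [Matrix.mulVec, dotProduct]
    rw [h2, hT, ← hself]
    conv_lhs => rw [map_sum]
    rw [map_sum]
    refine Finset.sum_congr rfl fun j _ => ?_
    rw [map_smul, hB, hcoord, smul_eq_mul, map_pow, eval_X, pow_succ']

end Hermitian

theorem exists_eval_add_ne_zero_of_thasEq {F : Type*} [Field F] {m D k : ℕ}
    {f : MvPolynomial (Fin m) F} (hf : f.IsHomogeneous D) (hthas : ThasEq f k)
    {W : Submodule F (Fin m → F)} (hk : Module.finrank F W = k + 1) (hW : SubInX f W)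
    {u : Fin m → F} (hu : u ∉ W) : ∃ w ∈ W, eval (u + w) f ≠ 0 := by
  by_contra! hcon
  refine hthas.2 ⟨W ⊔ F ∙ u, ?_, fun z hz => ?_⟩
  · have hu0 : u ≠ 0 := fun h => hu (h ▸ W.zero_mem)
    have h1 := Submodule.finrank_sup_add_finrank_inf_eq W (F ∙ u)
    have h2 : W ⊓ F ∙ u = ⊥ :=
      ((Submodule.disjoint_span_singleton' hu0).2 hu).eq_bot
    rw [h2, finrank_bot, finrank_span_singleton hu0, hk] at h1
    exact h1
  · obtain ⟨w, hw, y, hy, rfl⟩ := Submodule.mem_sup.1 hz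
    obtain ⟨c, rfl⟩ := Submodule.mem_span_singleton.1 hy
    by_cases hc : c = 0
    · simpa [hc] using hW w hw
    · have : w + c • u = c • (u + c⁻¹ • w) := by
        rw [smul_add, smul_inv_smul₀ hc, add_comm]
      rw [this, hf.eval_smul', hcon _ (W.smul_mem _ hw), mul_zero]

theorem Theta_mul_add_one {q s n k : ℕ} (hq : 0 < q) (hk : k ≤ n) :
    Theta q (s + 1) n k * (q - 1) + 1 + s * q ^ k = q ^ (k + 1) + s * q ^ (n + 1) := by
  have h1 := NP_mul q (n - k) hq
  have h2 := NP_mul q k hq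
  have h3 : q ^ (n + 1) = q ^ k * q ^ (n - k + 1) := by
    rw [← pow_add]
    congr 1
    omega
  rw [Theta, Nat.add_sub_cancel, h3, ← h1, ← h2]
  ring

theorem stmt19 {F : Type*} [Field F] [Fintype F] {n k s : ℕ}
    (hq : Fintype.card F = s ^ 2) (hn : Even n) (hn2 : 2 ≤ n)
    (hk1 : 0 < k) (hkn : k ≤ n - 1)
    (f : MvPolynomial (Fin (n + 2)) F) (hf0 : f ≠ 0) (hsq : Squarefree f)
    (hhom : f.IsHomogeneous (s + 1)) (hthas : ThasEq f k)
    (heq : numPoints f = Theta (Fintype.card F) (s + 1) n k)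
    (hns : ¬ ∃ v : Fin (n + 2) → F, IsSingPt f v) :
    2 * k = n ∧
    ∃ (T : Matrix (Fin (n + 2)) (Fin (n + 2)) F) (c : F), IsUnit T.det ∧ c ≠ 0 ∧
      MvPolynomial.aeval (fun i => ∑ j, MvPolynomial.C (T i j) * MvPolynomial.X j) f
        = MvPolynomial.C c * ∑ i : Fin (n + 2), MvPolynomial.X i ^ (s + 1) := by
  classical
  obtain ⟨W, hk, hW⟩ := hthas.1
  have hmax : ∀ u ∉ W, ∃ w ∈ W, eval (u + w) f ≠ 0 := fun u hu =>
    exists_eval_add_ne_zero_of_thasEq hhom hthas hk hW hu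
  have h : IsExtremalSubspace s f W := by
    refine isExtremalSubspace_of_card_zeros hq hhom hW hk hmax ?_
    rw [hhom.card_zeros_eq s.succ_ne_zero, heq]
    exact Theta_mul_add_one Fintype.card_pos (by omega)
  have h2k : 2 * Module.finrank F W = n + 2 := h.two_mul_finrank fun w hw hw0 => by
    by_contra! hcon
    refine hns ⟨w, hw0, hW w hw, fun i => ?_⟩
    have := hcon (Pi.single i 1)
    simpa [dirDeriv, Pi.single_apply] using this
  refine ⟨by omega, ?_⟩
  have hf : ∃ u, eval u f ≠ 0 := by
    have hne : W ≠ ⊤ := fun htop => by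
      rw [htop, finrank_top, Module.finrank_fin_fun] at hk
      omega
    obtain ⟨u, hu⟩ := SetLike.exists_not_mem_of_ne_top W hne rfl
    obtain ⟨w, -, hw⟩ := hmax u hu
    exact ⟨_, hw⟩
  obtain ⟨μ, hμ, hμs⟩ := h.exists_mul_eval_pow_eq (by omega) hf
  have hg : (MvPolynomial.C μ * f).IsHomogeneous (s + 1) := by
    simpa using (MvPolynomial.isHomogeneous_C _ μ).mul hhom
  obtain ⟨T, hT, hTf⟩ := hg.exists_eq_sum_X_pow hq
    (fun u => by simpa using hμs u) fun ⟨v, hv0, hv, hvi⟩ =>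
      hns ⟨v, hv0, by simpa [hμ] using hv, fun i => by simpa [hμ] using hvi i⟩
  refine ⟨T, μ⁻¹, hT, inv_ne_zero hμ, ?_⟩
  rw [← hTf, map_mul, MvPolynomial.aeval_C, MvPolynomial.algebraMap_eq, ← mul_assoc,
    ← MvPolynomial.C_mul, inv_mul_cancel₀ hμ, MvPolynomial.C_1, one_mul]
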